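/- Let N ≥ 3, 0 < μ ≤ μ₀ = (N-2)²/4, and let V ∈ C^γ_loc(ℝ^N∖{0}) (γ ∈ (0,1)) be a positive potential with V(x) ≥ |x|^{-2} for all x ≠ 0 and lim_{x→0} V(x)|x|² = 1. If u is a classical solution of -Δu - μVu = 0 in ℝ^N∖{0}, not identically zero, which is nonnegative on B_r(0)∖{0} for some r > 0, then there exists k ≥ 0 such that u satisfies the dμ-distributional identity with constant k, i.e. ∫_{ℝ^N} u(x) L*_{μV}ξ(x) |x|^{τ₊(μ)} dx = c_μ k ξ(0) for every compactly supported C^{1,1} function ξ on ℝ^N. -/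

import Mathlib

open Filter MeasureTheory Metric

noncomputable section

/-- Euclidean space ℝ^N. -/
abbrev Euc (N : ℕ) : Type := EuclideanSpace ℝ (Fin N)

/-- The Laplacian of `u` at `x`, as the sum of the pure second derivatives in the
coordinate directions. -/
def lap {N : ℕ} (u : Euc N → ℝ) (x : Euc N) : ℝ :=
  ∑ i : Fin N, fderiv ℝ (fun y => fderiv ℝ u y (EuclideanSpace.single i 1)) x
    (EuclideanSpace.single i 1)

/-- μ₀ = (N-2)²/4. -/
def mu0 (N : ℕ) : ℝ := ((N : ℝ) - 2) ^ 2 / 4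

/-- τ₋(μ) = -(N-2)/2 - √(μ₀-μ). -/
def tauMinus (N : ℕ) (μ : ℝ) : ℝ := -((N : ℝ) - 2) / 2 - Real.sqrt (mu0 N - μ)

/-- τ₊(μ) = -(N-2)/2 + √(μ₀-μ). -/
def tauPlus (N : ℕ) (μ : ℝ) : ℝ := -((N : ℝ) - 2) / 2 + Real.sqrt (mu0 N - μ)

/-- Surface area of the unit sphere in ℝ^N, i.e. N times the volume of the unit ball. -/
def sphereArea (N : ℕ) : ℝ := N * (volume (ball (0 : Euc N) 1)).toReal

/-- The normalizing constant c_μ: 2√(μ₀-μ)|𝕊^{N-1}| for μ < μ₀ and |𝕊^{N-1}| for μ = μ₀. -/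
def cMu (N : ℕ) (μ : ℝ) : ℝ :=
  if μ < mu0 N then 2 * Real.sqrt (mu0 N - μ) * sphereArea N else sphereArea N

/-- The normalizing constant c_N = ((N-2)|𝕊^{N-1}|)⁻¹ of the fundamental solution of -Δ. -/
def cN (N : ℕ) : ℝ := (((N : ℝ) - 2) * sphereArea N)⁻¹

/-- The singular profile Φ_μ: |x|^{τ₋(μ)} for μ < μ₀ and |x|^{-(N-2)/2}(-ln|x|) for μ = μ₀. -/
def PhiFun (N : ℕ) (μ : ℝ) (x : Euc N) : ℝ :=
  if μ < mu0 N then ‖x‖ ^ tauMinus N μ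
  else ‖x‖ ^ (-((N : ℝ) - 2) / 2) * (-Real.log ‖x‖)

/-- The adjoint operator L*_μ ξ(x) = -Δξ(x) - 2τ₊(μ)|x|⁻² x·∇ξ(x). -/
def LstarMu (N : ℕ) (μ : ℝ) (ξ : Euc N → ℝ) (x : Euc N) : ℝ :=
  -lap ξ x - 2 * tauPlus N μ / ‖x‖ ^ 2 * fderiv ℝ ξ x x

/-- The adjoint operator L*_{μV} ξ = L*_μ ξ - μ(V - |x|⁻²)ξ. -/
def LstarMuV (N : ℕ) (μ : ℝ) (V ξ : Euc N → ℝ) (x : Euc N) : ℝ :=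
  LstarMu N μ ξ x - μ * (V x - ‖x‖ ^ (-2 : ℝ)) * ξ x

/-- A compactly supported C^{1,1} test function: compactly supported, differentiable,
with Lipschitz gradient. -/
def IsC11c {N : ℕ} (ξ : Euc N → ℝ) : Prop :=
  HasCompactSupport ξ ∧ Differentiable ℝ ξ ∧ ∃ L : NNReal, LipschitzWith L (fderiv ℝ ξ)

/-- The dμ-distributional identity with constant `k`. -/
def DistribIdentity (N : ℕ) (μ : ℝ) (V u : Euc N → ℝ) (k : ℝ) : Prop :=
  ∀ ξ : Euc N → ℝ, IsC11c ξ →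
    ∫ x : Euc N, u x * LstarMuV N μ V ξ x * ‖x‖ ^ tauPlus N μ = cMu N μ * k * ξ 0

/-- `u` is a classical solution of -Δu - μVu = 0 in ℝ^N∖{0}. -/
def IsSolution (N : ℕ) (μ : ℝ) (V u : Euc N → ℝ) : Prop :=
  ContDiffOn ℝ 2 u {x : Euc N | x ≠ 0} ∧
  ∀ x : Euc N, x ≠ 0 → -lap u x - μ * V x * u x = 0

/-- `f` is locally γ-Hölder continuous on `s`. -/
def LocHolderOn {N : ℕ} (γ : ℝ) (s : Set (Euc N)) (f : Euc N → ℝ) : Prop :=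
  ∀ x ∈ s, ∃ ε > 0, ∃ C > 0, ∀ y ∈ ball x ε ∩ s, ∀ z ∈ ball x ε ∩ s,
    |f y - f z| ≤ C * dist y z ^ γ

/-- The filter `‖x‖ → +∞` on ℝ^N. -/
def normAtTop (N : ℕ) : Filter (Euc N) := comap norm atTop

/-- Assumption (V): V is locally Hölder and positive on ℝ^N∖{0},
0 ≤ V(x) - |x|⁻² ≤ c₀, and limsup_{|x|→∞} V(x)|x|² = α. -/
def AssumpV (N : ℕ) (V : Euc N → ℝ) (α : ℝ) : Prop :=
  (∃ γ : ℝ, 0 < γ ∧ γ < 1 ∧ LocHolderOn γ {x : Euc N | x ≠ 0} V) ∧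
  (∀ x : Euc N, x ≠ 0 → 0 < V x) ∧
  (∃ c₀ : ℝ, 0 < c₀ ∧ ∀ x : Euc N, x ≠ 0 →
    0 ≤ V x - ‖x‖ ^ (-2 : ℝ) ∧ V x - ‖x‖ ^ (-2 : ℝ) ≤ c₀) ∧
  limsup (fun x : Euc N => V x * ‖x‖ ^ 2) (normAtTop N) = α

/-- Assumption (Ṽ): V is locally Hölder and positive on ℝ^N∖{0},
0 ≤ V(x) - |x|⁻² ≤ c₀, and liminf_{|x|→∞} V(x)|x|² = β. -/
def AssumpVtilde (N : ℕ) (V : Euc N → ℝ) (β : ℝ) : Prop :=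
  (∃ γ : ℝ, 0 < γ ∧ γ < 1 ∧ LocHolderOn γ {x : Euc N | x ≠ 0} V) ∧
  (∀ x : Euc N, x ≠ 0 → 0 < V x) ∧
  (∃ c₀ : ℝ, 0 < c₀ ∧ ∀ x : Euc N, x ≠ 0 →
    0 ≤ V x - ‖x‖ ^ (-2 : ℝ) ∧ V x - ‖x‖ ^ (-2 : ℝ) ≤ c₀) ∧
  liminf (fun x : Euc N => V x * ‖x‖ ^ 2) (normAtTop N) = β

/-- The potential V_ρ(x) = |x|⁻²(1 + ρ|x|²)/(1 + |x|²). -/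
def Vrho (N : ℕ) (ρ : ℝ) (x : Euc N) : ℝ :=
  ‖x‖ ^ (-2 : ℝ) * (1 + ρ * ‖x‖ ^ 2) / (1 + ‖x‖ ^ 2)

/-- Ω has C² boundary: it is the sublevel set of a C² function whose differential
does not vanish on the boundary. -/
def HasC2Boundary {N : ℕ} (Ω : Set (Euc N)) : Prop :=
  ∃ φ : Euc N → ℝ, ContDiff ℝ 2 φ ∧ Ω = {x | φ x < 0} ∧
    ∀ x ∈ frontier Ω, fderiv ℝ φ x ≠ 0

open scoped Topology Manifold

/-- Integration by parts of a `C¹` function on the punctured space against a compactly supported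
Lipschitz function vanishing near the origin. -/
theorem integral_mul_fderiv_of_vanish_near_zero {N : ℕ} {F ξ : Euc N → ℝ} {C : NNReal}
    (hF : ContDiffOn ℝ 1 F {x | x ≠ 0}) (hξ : LipschitzWith C ξ) (hc : HasCompactSupport ξ)
    (h0 : ξ =ᶠ[𝓝 0] 0) (v : Euc N) :
    Integrable (fun x => F x * fderiv ℝ ξ x v) ∧ Integrable (fun x => fderiv ℝ F x v * ξ x) ∧
    ∫ x, F x * fderiv ℝ ξ x v = -∫ x, fderiv ℝ F x v * ξ x := by
  obtain ⟨R, hR⟩ := hc.isCompact.isBounded.subset_ball (0 : Euc N)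
  have h0t : (0 : Euc N) ∉ tsupport ξ := by rwa [notMem_tsupport_iff_eventuallyEq]
  obtain ⟨χ, hχ0, hχ1, -⟩ := exists_contMDiffMap_zero_one_nhds_of_isClosed (n := 1) 𝓘(ℝ, Euc N)
    (s := {0} ∪ (ball (0 : Euc N) R)ᶜ) (t := tsupport ξ)
    (isClosed_singleton.union isOpen_ball.isClosed_compl) (isClosed_tsupport ξ) (by
      rw [Set.disjoint_left]
      rintro x (hx | hx) hxt
      · rw [Set.mem_singleton_iff] at hx
        exact h0t (hx ▸ hxt)
      · exact hx (hR hxt))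
  have hχd : ContDiff ℝ 1 χ := contMDiff_iff_contDiff.1 χ.contMDiff
  rw [eventually_nhdsSet_iff_forall] at hχ0 hχ1
  have hχz : ∀ᶠ x in 𝓝 (0 : Euc N), χ x = 0 := hχ0 0 (by simp)
  set G : Euc N → ℝ := fun x => χ x * F x with hG
  have hGd : ContDiff ℝ 1 G := by
    rw [contDiff_iff_contDiffAt]
    intro x
    by_cases hx : x = 0
    · subst hx
      refine (contDiffAt_const (c := (0 : ℝ))).congr_of_eventuallyEq ?_
      filter_upwards [hχz] with y hy
      simp [hG, hy]
    · exact hχd.contDiffAt.mul (hF.contDiffAt (isOpen_ne.mem_nhds hx))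
  have hGc : HasCompactSupport G := by
    refine HasCompactSupport.intro (isCompact_closedBall (0 : Euc N) R) fun x hx => ?_
    have : χ x = 0 := (hχ0 x (Or.inr fun h => hx (ball_subset_closedBall h))).self_of_nhds
    simp [hG, this]
  obtain ⟨D, hGL⟩ := ContDiff.lipschitzWith_of_hasCompactSupport hGc hGd one_ne_zero
  have e1 : (fun x => F x * fderiv ℝ ξ x v) = fun x => G x * fderiv ℝ ξ x v := by
    funext x
    by_cases hx : x ∈ tsupport ξ
    · simp [hG, (hχ1 x hx).self_of_nhds]
    · have : fderiv ℝ ξ x = 0 := by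
        by_contra h
        exact hx (support_fderiv_subset ℝ h)
      simp [this]
  have e2 : (fun x => fderiv ℝ F x v * ξ x) = fun x => fderiv ℝ G x v * ξ x := by
    funext x
    by_cases hx : x ∈ tsupport ξ
    · have : G =ᶠ[𝓝 x] F := by
        filter_upwards [hχ1 x hx] with y hy
        simp [hG, hy]
      rw [this.fderiv_eq]
    · simp [image_eq_zero_of_notMem_tsupport hx]
  have key := LipschitzWith.integral_lineDeriv_mul_eq (μ := volume) hξ hGL hGc v
  have e3 : ∀ᵐ x, lineDeriv ℝ ξ x v = fderiv ℝ ξ x v := by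
    filter_upwards [hξ.ae_differentiableAt (μ := volume)] with x hx
    exact hx.lineDeriv_eq_fderiv
  have e4 : ∀ x, lineDeriv ℝ G x (-v) = -fderiv ℝ G x v := fun x => by
    rw [(hGd.differentiable one_ne_zero x).lineDeriv_eq_fderiv, map_neg]
  refine ⟨?_, ?_, ?_⟩
  · rw [e1]
    have hGi : Integrable G := hGd.continuous.integrable_of_hasCompactSupport hGc
    refine hGi.mul_bdd (c := C * ‖v‖) ?_ ?_
    · exact (measurable_fderiv_apply_const ℝ ξ v).aestronglyMeasurable
    · refine ae_of_all _ fun x => ?_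
      exact (ContinuousLinearMap.le_opNorm _ _).trans
        (mul_le_mul_of_nonneg_right (norm_fderiv_le_of_lipschitz ℝ hξ) (norm_nonneg _))
  · rw [e2]
    exact ((((hGd.continuous_fderiv one_ne_zero).clm_apply continuous_const).mul
      hξ.continuous)).integrable_of_hasCompactSupport hc.mul_left
  · rw [e1, e2, ← integral_neg]
    calc ∫ x, G x * fderiv ℝ ξ x v = ∫ x, lineDeriv ℝ ξ x v * G x := by
          refine integral_congr_ae ?_
          filter_upwards [e3] with x hx
          rw [hx, mul_comm]
      _ = _ := by
          rw [key]
          refine integral_congr_ae (ae_of_all _ fun x => ?_)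
          simp only [e4, neg_mul]

theorem hasFDerivAt_comp_norm {N : ℕ} {φ : ℝ → ℝ} {d : ℝ} {x : Euc N} (hx : x ≠ 0)
    (h : HasDerivAt φ d ‖x‖) :
    HasFDerivAt (fun y : Euc N => φ ‖y‖) ((d / ‖x‖) • innerSL ℝ x) x := by
  have h1 : HasFDerivAt (fun y : Euc N => ‖y‖) (‖x‖⁻¹ • innerSL ℝ x) x := by
    have h2 := (hasStrictFDerivAt_norm_sq x).hasFDerivAt.sqrt (by positivity)
    simp only [Real.sqrt_sq (norm_nonneg _)] at h2
    have h3 : (1 / (2 * ‖x‖)) • (2 • innerSL ℝ x) = ‖x‖⁻¹ • innerSL ℝ x := by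
      rw [← Nat.cast_smul_eq_nsmul ℝ 2, smul_smul]
      congr 1
      push_cast
      field_simp
    rwa [h3] at h2
  have := h.comp_hasFDerivAt x h1
  rwa [smul_smul, ← div_eq_mul_inv] at this

theorem fderiv_comp_norm {N : ℕ} {φ : ℝ → ℝ} {d : ℝ} {x : Euc N} (hx : x ≠ 0)
    (h : HasDerivAt φ d ‖x‖) (v : Euc N) :
    fderiv ℝ (fun y : Euc N => φ ‖y‖) x v = d / ‖x‖ * inner ℝ x v := by
  rw [(hasFDerivAt_comp_norm hx h).fderiv]
  simp

theorem inner_single_one {N : ℕ} (x : Euc N) (i : Fin N) :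
    inner ℝ x (EuclideanSpace.single i (1 : ℝ)) = x i := by
  simp [EuclideanSpace.inner_single_right]

/-- The `i`-th partial derivative of a radial function, differentiated once more. -/
theorem hasFDerivAt_partial_comp_norm {N : ℕ} {φ φ' φ'' : ℝ → ℝ}
    (h1 : ∀ r, 0 < r → HasDerivAt φ (φ' r) r) (h2 : ∀ r, 0 < r → HasDerivAt φ' (φ'' r) r)
    {x : Euc N} (hx : x ≠ 0) (i : Fin N) :
    HasFDerivAt (fun y => fderiv ℝ (fun z : Euc N => φ ‖z‖) y (EuclideanSpace.single i 1))
      ((φ' ‖x‖ / ‖x‖) • EuclideanSpace.proj i +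
        x i • (((φ'' ‖x‖ * ‖x‖ - φ' ‖x‖) / ‖x‖ ^ 2 / ‖x‖) • innerSL ℝ x)) x := by
  have hr : 0 < ‖x‖ := norm_pos_iff.2 hx
  have hq : HasDerivAt (fun r => φ' r / r) ((φ'' ‖x‖ * ‖x‖ - φ' ‖x‖) / ‖x‖ ^ 2) ‖x‖ := by
    simpa using (h2 _ hr).fun_div (hasDerivAt_id' ‖x‖) hr.ne'
  have h3 := (hasFDerivAt_comp_norm hx hq).fun_mul
    ((EuclideanSpace.proj i : Euc N →L[ℝ] ℝ).hasFDerivAt (x := x))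
  refine h3.congr_of_eventuallyEq ?_
  filter_upwards [isOpen_ne.mem_nhds hx] with y hy
  rw [fderiv_comp_norm hy (h1 _ (norm_pos_iff.2 hy)), inner_single_one]
  rfl

theorem lap_comp_norm {N : ℕ} {φ φ' φ'' : ℝ → ℝ}
    (h1 : ∀ r, 0 < r → HasDerivAt φ (φ' r) r) (h2 : ∀ r, 0 < r → HasDerivAt φ' (φ'' r) r)
    {x : Euc N} (hx : x ≠ 0) :
    lap (fun y : Euc N => φ ‖y‖) x = φ'' ‖x‖ + ((N : ℝ) - 1) / ‖x‖ * φ' ‖x‖ := by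
  have hr : 0 < ‖x‖ := norm_pos_iff.2 hx
  have hs : ∑ i : Fin N, x i * x i = ‖x‖ ^ 2 := by
    rw [EuclideanSpace.norm_sq_eq]
    simp [sq]
  have : ∀ i : Fin N, fderiv ℝ (fun y => fderiv ℝ (fun z : Euc N => φ ‖z‖) y
      (EuclideanSpace.single i 1)) x (EuclideanSpace.single i 1) =
      φ' ‖x‖ / ‖x‖ + ((φ'' ‖x‖ * ‖x‖ - φ' ‖x‖) / ‖x‖ ^ 2 / ‖x‖) * (x i * x i) := fun i => by
    rw [(hasFDerivAt_partial_comp_norm h1 h2 hx i).fderiv]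
    simp [EuclideanSpace.inner_single_right]
    ring
  simp only [lap, this, Finset.sum_add_distrib, ← Finset.mul_sum, hs]
  simp
  field_simp
  ring

theorem lap_mul {N : ℕ} {f g : Euc N → ℝ} {x : Euc N}
    (hf : ∀ᶠ y in 𝓝 x, DifferentiableAt ℝ f y) (hg : ∀ᶠ y in 𝓝 x, DifferentiableAt ℝ g y)
    (hf' : ∀ i : Fin N,
      DifferentiableAt ℝ (fun y => fderiv ℝ f y (EuclideanSpace.single i 1)) x)
    (hg' : ∀ i : Fin N,
      DifferentiableAt ℝ (fun y => fderiv ℝ g y (EuclideanSpace.single i 1)) x) :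
    lap (fun y => f y * g y) x = f x * lap g x + g x * lap f x +
      2 * ∑ i : Fin N, fderiv ℝ f x (EuclideanSpace.single i 1) *
        fderiv ℝ g x (EuclideanSpace.single i 1) := by
  simp only [lap, Finset.mul_sum, ← Finset.sum_add_distrib]
  refine Finset.sum_congr rfl fun i _ => ?_
  have h1 : (fun y => fderiv ℝ (fun y => f y * g y) y (EuclideanSpace.single i 1)) =ᶠ[𝓝 x]
      fun y => f y * fderiv ℝ g y (EuclideanSpace.single i 1) +
        g y * fderiv ℝ f y (EuclideanSpace.single i 1) := by
    filter_upwards [hf, hg] with y h1 h2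
    rw [fderiv_fun_mul h1 h2]
    simp
  rw [h1.fderiv_eq, fderiv_fun_add (hf.self_of_nhds.fun_mul (hg' i)) (hg.self_of_nhds.fun_mul (hf' i)),
    fderiv_fun_mul hf.self_of_nhds (hg' i), fderiv_fun_mul hg.self_of_nhds (hf' i)]
  simp
  ring

theorem tauPlus_add (N : ℕ) (μ : ℝ) :
    (N : ℝ) - 1 + 2 * tauPlus N μ = 1 + 2 * Real.sqrt (mu0 N - μ) := by
  unfold tauPlus
  ring

/-- The radial form of `L*_μ`, in terms of the first two derivatives `a`, `b` at radius `r`. -/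
def radialOp (N : ℕ) (μ a b r : ℝ) : ℝ := -(b + (1 + 2 * Real.sqrt (mu0 N - μ)) / r * a)

theorem LstarMu_comp_norm {N : ℕ} {μ : ℝ} {φ φ' φ'' : ℝ → ℝ}
    (h1 : ∀ r, 0 < r → HasDerivAt φ (φ' r) r) (h2 : ∀ r, 0 < r → HasDerivAt φ' (φ'' r) r)
    {x : Euc N} (hx : x ≠ 0) :
    LstarMu N μ (fun y : Euc N => φ ‖y‖) x = radialOp N μ (φ' ‖x‖) (φ'' ‖x‖) ‖x‖ := by
  have hr : 0 < ‖x‖ := norm_pos_iff.2 hx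
  rw [LstarMu, lap_comp_norm h1 h2 hx, fderiv_comp_norm hx (h1 _ hr), radialOp, ← tauPlus_add,
    real_inner_self_eq_norm_sq]
  field_simp
  ring

theorem LstarMu_mul_comp_norm {N : ℕ} {μ : ℝ} {φ φ' φ'' : ℝ → ℝ} {ζ : Euc N → ℝ}
    (h1 : ∀ r, 0 < r → HasDerivAt φ (φ' r) r) (h2 : ∀ r, 0 < r → HasDerivAt φ' (φ'' r) r)
    {x : Euc N} (hx : x ≠ 0) (hζ : Differentiable ℝ ζ)
    (hζ' : DifferentiableAt ℝ (fderiv ℝ ζ) x) :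
    LstarMu N μ (fun y : Euc N => ζ y * φ ‖y‖) x = φ ‖x‖ * LstarMu N μ ζ x +
      ζ x * radialOp N μ (φ' ‖x‖) (φ'' ‖x‖) ‖x‖ - 2 * φ' ‖x‖ / ‖x‖ * fderiv ℝ ζ x x := by
  have hr : 0 < ‖x‖ := norm_pos_iff.2 hx
  have hd : ∀ y : Euc N, y ≠ 0 → DifferentiableAt ℝ (fun y : Euc N => φ ‖y‖) y := fun y hy =>
    (hasFDerivAt_comp_norm hy (h1 _ (norm_pos_iff.2 hy))).differentiableAt
  have hsum : ∑ i : Fin N, fderiv ℝ ζ x (EuclideanSpace.single i 1) * x i = fderiv ℝ ζ x x := by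
    have h := congrArg (fderiv ℝ ζ x) ((EuclideanSpace.basisFun (Fin N) ℝ).sum_repr x)
    rw [map_sum] at h
    rw [← h]
    simp [mul_comm]
  rw [← LstarMu_comp_norm h1 h2 hx, LstarMu, LstarMu, LstarMu,
    lap_mul (Eventually.of_forall fun y => hζ y)
      (by filter_upwards [isOpen_ne.mem_nhds hx] with y hy using hd y hy)
      (fun i => hζ'.clm_apply (differentiableAt_const _))
      (fun i => (hasFDerivAt_partial_comp_norm h1 h2 hx i).differentiableAt),
    fderiv_fun_mul (hζ x) (hd x hx)]
  simp only [fderiv_comp_norm hx (h1 _ hr), inner_single_one, FunLike.coe_add, Pi.add_apply,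
    FunLike.coe_smul, Pi.smul_apply, smul_eq_mul]
  have : ∑ i : Fin N, fderiv ℝ ζ x (EuclideanSpace.single i 1) * (φ' ‖x‖ / ‖x‖ * x i) =
      φ' ‖x‖ / ‖x‖ * fderiv ℝ ζ x x := by
    rw [← hsum, Finset.mul_sum]
    exact Finset.sum_congr rfl fun i _ => by ring
  rw [this]
  ring

namespace IsC11c

variable {N : ℕ} {ξ η : Euc N → ℝ}

theorem contDiff (h : IsC11c ξ) : ContDiff ℝ 1 ξ := by
  obtain ⟨-, h1, L, hL⟩ := h
  exact contDiff_one_iff_fderiv.2 ⟨h1, hL.continuous⟩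

theorem exists_lipschitzWith (h : IsC11c ξ) : ∃ C, LipschitzWith C ξ :=
  ContDiff.lipschitzWith_of_hasCompactSupport h.1 h.contDiff one_ne_zero

theorem partial_lipschitzWith (h : IsC11c ξ) (v : Euc N) :
    ∃ C, LipschitzWith C (fun y => fderiv ℝ ξ y v) := by
  obtain ⟨-, -, L, hL⟩ := h
  exact ⟨_, ((ContinuousLinearMap.apply ℝ ℝ v).lipschitz).comp hL⟩

theorem ae_differentiableAt_fderiv (h : IsC11c ξ) :
    ∀ᵐ x, DifferentiableAt ℝ (fderiv ℝ ξ) x := by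
  obtain ⟨-, -, L, hL⟩ := h
  exact hL.ae_differentiableAt

theorem const_mul (h : IsC11c ξ) (c : ℝ) : IsC11c (fun x => c * ξ x) := by
  refine ⟨h.1.mul_left (f := fun _ => c), h.2.1.const_mul c, ?_⟩
  obtain ⟨L, hL⟩ := h.2.2
  have : fderiv ℝ (fun x => c * ξ x) = fun x => c • fderiv ℝ ξ x :=
    funext fun x => fderiv_const_mul (h.2.1 x) c
  rw [this]
  exact ⟨_, (lipschitzWith_smul c).comp hL⟩

theorem sub (h : IsC11c ξ) (h' : IsC11c η) : IsC11c (fun x => ξ x - η x) := by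
  refine ⟨h.1.sub h'.1, h.2.1.sub h'.2.1, ?_⟩
  obtain ⟨L, hL⟩ := h.2.2
  obtain ⟨L', hL'⟩ := h'.2.2
  have : fderiv ℝ (fun x => ξ x - η x) = fun x => fderiv ℝ ξ x - fderiv ℝ η x :=
    funext fun x => fderiv_fun_sub (h.2.1 x) (h'.2.1 x)
  rw [this]
  exact ⟨_, hL.sub hL'⟩

theorem of_contDiff (h : ContDiff ℝ 2 ξ) (hc : HasCompactSupport ξ) : IsC11c ξ :=
  ⟨hc, h.differentiable two_ne_zero,
    ContDiff.lipschitzWith_of_hasCompactSupport (hc.fderiv ℝ)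
      (h.fderiv_right (m := 1) (by norm_num)) one_ne_zero⟩

theorem mul (h : IsC11c ξ) (h' : IsC11c η) : IsC11c (fun x => ξ x * η x) := by
  refine ⟨h.1.mul_right, h.2.1.mul h'.2.1, ?_⟩
  have aux : ∀ {f g : Euc N → ℝ}, IsC11c f → IsC11c g →
      ∃ L, LipschitzWith L (fun x => f x • fderiv ℝ g x) := by
    intro f g hf hg
    obtain ⟨A, hA⟩ := hf.1.exists_bound_of_continuous hf.contDiff.continuous
    obtain ⟨B, hB⟩ := (hg.1.fderiv ℝ).exists_bound_of_continuous
      (hg.contDiff.continuous_fderiv one_ne_zero)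
    obtain ⟨K, hK⟩ := hf.exists_lipschitzWith
    obtain ⟨L, hL⟩ := hg.2.2
    refine ⟨A.toNNReal * L + B.toNNReal * K, LipschitzWith.of_dist_le_mul fun x y => ?_⟩
    have hA' : ∀ x, ‖f x‖ ≤ A.toNNReal := fun x => (hA x).trans (Real.le_coe_toNNReal A)
    have hB' : ∀ x, ‖fderiv ℝ g x‖ ≤ B.toNNReal := fun x => (hB x).trans (Real.le_coe_toNNReal B)
    have h1 := hK.dist_le_mul x y
    have h2 := hL.dist_le_mul x y
    rw [dist_eq_norm] at h1 h2 ⊢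
    have : f x • fderiv ℝ g x - f y • fderiv ℝ g y =
        f x • (fderiv ℝ g x - fderiv ℝ g y) + (f x - f y) • fderiv ℝ g y := by
      module
    rw [this]
    refine (norm_add_le _ _).trans ?_
    rw [norm_smul, norm_smul]
    have h3 := mul_le_mul (hA' x) h2 (norm_nonneg _) (NNReal.coe_nonneg _)
    have h4 := mul_le_mul h1 (hB' y) (norm_nonneg _) (by positivity)
    push_cast
    linarith
  obtain ⟨L, hL⟩ := aux h h'
  obtain ⟨L', hL'⟩ := aux h' h
  have : fderiv ℝ (fun x => ξ x * η x) =
      fun x => ξ x • fderiv ℝ η x + η x • fderiv ℝ ξ x :=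
    funext fun x => fderiv_fun_mul (h.2.1 x) (h'.2.1 x)
  rw [this]
  exact ⟨_, hL.add hL'⟩

end IsC11c

theorem hasDerivAt_rpow_left {τ r : ℝ} (hr : 0 < r) :
    HasDerivAt (fun r : ℝ => r ^ τ) (τ * r ^ (τ - 1)) r :=
  Real.hasDerivAt_rpow_const (Or.inl hr.ne')

theorem lap_norm_rpow_tauPlus {N : ℕ} {μ : ℝ} (hμ0 : μ ≤ mu0 N) {x : Euc N} (hx : x ≠ 0) :
    lap (fun y : Euc N => ‖y‖ ^ tauPlus N μ) x =
      -μ * ‖x‖ ^ (-2 : ℝ) * ‖x‖ ^ tauPlus N μ := by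
  have hr : 0 < ‖x‖ := norm_pos_iff.2 hx
  rw [lap_comp_norm (fun r hr => hasDerivAt_rpow_left hr)
    (fun r hr => (hasDerivAt_rpow_left hr).const_mul (tauPlus N μ)) hx]
  set τ := tauPlus N μ with hτ
  have hq : τ * (τ - 1) + (N - 1) * τ = -μ := by
    have := Real.sq_sqrt (sub_nonneg.2 hμ0)
    rw [hτ, tauPlus]
    unfold mu0 at *
    ring_nf at this ⊢
    linarith
  have e1 : ‖x‖ ^ (τ - 1) = ‖x‖ ^ τ * ‖x‖⁻¹ := by
    rw [Real.rpow_sub hr, Real.rpow_one, div_eq_mul_inv]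
  have e2 : ‖x‖ ^ (τ - 1 - 1) = ‖x‖ ^ τ * ‖x‖⁻¹ * ‖x‖⁻¹ := by
    rw [Real.rpow_sub hr, Real.rpow_one, div_eq_mul_inv, e1]
  have e3 : ‖x‖ ^ (-2 : ℝ) = ‖x‖⁻¹ * ‖x‖⁻¹ := by
    rw [Real.rpow_neg hr.le, ← mul_inv]
    norm_num [sq]
  rw [e1, e2, e3, ← hq]
  ring

theorem integral_mul_LstarMuV_of_vanish_near_zero {N : ℕ} (hN : 3 ≤ N) {μ : ℝ} (hμ0 : μ ≤ mu0 N)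
    {V u : Euc N → ℝ} (hu : IsSolution N μ V u) {ξ : Euc N → ℝ} (hξ : IsC11c ξ)
    (h0 : ξ =ᶠ[𝓝 0] 0) :
    Integrable (fun x => u x * LstarMuV N μ V ξ x * ‖x‖ ^ tauPlus N μ) ∧
      ∫ x, u x * LstarMuV N μ V ξ x * ‖x‖ ^ tauPlus N μ = 0 := by
  have : NeZero N := ⟨by omega⟩
  obtain ⟨hu2, hsol⟩ := hu
  set τ := tauPlus N μ with hτ
  set Γ : Euc N → ℝ := fun x => ‖x‖ ^ τ with hΓ
  set e : Fin N → Euc N := fun i => EuclideanSpace.single i 1 with he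
  have hopen : IsOpen {x : Euc N | x ≠ 0} := isOpen_ne
  have hΓ2 : ContDiffOn ℝ 2 Γ {x | x ≠ 0} := fun x hx =>
    ((contDiffAt_norm ℝ hx).rpow_const_of_ne (norm_ne_zero_iff.2 hx)).contDiffWithinAt
  have hpart : ∀ {f : Euc N → ℝ}, ContDiffOn ℝ 2 f {x | x ≠ 0} → ∀ i,
      ContDiffOn ℝ 1 (fun y => fderiv ℝ f y (e i)) {x | x ≠ 0} := fun hf i =>
    (hf.fderiv_of_isOpen hopen (by norm_num)).clm_apply contDiffOn_const
  have hdiff : ∀ {f : Euc N → ℝ}, ContDiffOn ℝ 1 f {x | x ≠ 0} → ∀ x, x ≠ 0 →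
      DifferentiableAt ℝ f x := fun hf x hx =>
    (hf.contDiffAt (hopen.mem_nhds hx)).differentiableAt one_ne_zero
  have hu1 : ContDiffOn ℝ 1 u {x | x ≠ 0} := hu2.of_le (by norm_num)
  have hΓ1 : ContDiffOn ℝ 1 Γ {x | x ≠ 0} := hΓ2.of_le (by norm_num)
  set F : Fin N → Euc N → ℝ := fun i x =>
    Γ x * fderiv ℝ u x (e i) - u x * fderiv ℝ Γ x (e i) with hF
  have hF1 : ∀ i, ContDiffOn ℝ 1 (F i) {x | x ≠ 0} := fun i =>
    (hΓ1.mul (hpart hu2 i)).sub (hu1.mul (hpart hΓ2 i))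
  have hpc : ∀ i, HasCompactSupport (fun y => fderiv ℝ ξ y (e i)) := fun i =>
    (hξ.1.fderiv ℝ).comp_left (g := fun l : Euc N →L[ℝ] ℝ => l (e i)) rfl
  have hp0 : ∀ i, (fun y => fderiv ℝ ξ y (e i)) =ᶠ[𝓝 0] 0 := fun i => by
    filter_upwards [h0.eventuallyEq_nhds] with y hy
    rw [hy.fderiv_eq]
    simp
  choose K hK using fun i => hξ.partial_lipschitzWith (e i)
  obtain ⟨C, hC⟩ := hξ.exists_lipschitzWith
  have I1 := fun i => integral_mul_fderiv_of_vanish_near_zero (F := fun x => u x * Γ x)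
    (hu1.mul hΓ1) (hK i) (hpc i) (hp0 i) (e i)
  have I2 := fun i => integral_mul_fderiv_of_vanish_near_zero (hF1 i) hC hξ.1 h0 (e i)
  have hdiv : ∀ x, x ≠ 0 → ∑ i, fderiv ℝ (F i) x (e i) =
      -μ * (V x - ‖x‖ ^ (-2 : ℝ)) * (u x * Γ x) := by
    intro x hx
    have h1 : ∀ i, fderiv ℝ (F i) x (e i) =
        Γ x * fderiv ℝ (fun y => fderiv ℝ u y (e i)) x (e i) -
          u x * fderiv ℝ (fun y => fderiv ℝ Γ y (e i)) x (e i) := fun i => by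
      have hpu := hdiff (hpart hu2 i) x hx
      have hpΓ := hdiff (hpart hΓ2 i) x hx
      have hux := hdiff hu1 x hx
      have hΓx := hdiff hΓ1 x hx
      simp only [hF]
      rw [fderiv_fun_sub (hΓx.fun_mul hpu) (hux.fun_mul hpΓ), fderiv_fun_mul hΓx hpu,
        fderiv_fun_mul hux hpΓ]
      simp
      ring
    simp only [h1, Finset.sum_sub_distrib, ← Finset.mul_sum]
    have h2 := hsol x hx
    have h3 := lap_norm_rpow_tauPlus hμ0 hx
    change Γ x * lap u x - u x * lap Γ x = _
    change lap Γ x = -μ * _ * Γ x at h3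
    rw [h3]
    linear_combination (-Γ x) * h2
  have hae : ∀ᵐ x : Euc N, x ≠ 0 := by
    simp [ae_iff]
  have key : (fun x => u x * LstarMuV N μ V ξ x * ‖x‖ ^ τ) =ᵐ[volume] fun x => ∑ i,
      ((F i x * fderiv ℝ ξ x (e i) + fderiv ℝ (F i) x (e i) * ξ x) -
      (u x * Γ x * fderiv ℝ (fun y => fderiv ℝ ξ y (e i)) x (e i) +
        fderiv ℝ (fun x => u x * Γ x) x (e i) * fderiv ℝ ξ x (e i))) := by
    filter_upwards [hae] with x hx
    have hr : 0 < ‖x‖ := norm_pos_iff.2 hx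
    have hsum : ∑ i : Fin N, x i * fderiv ℝ ξ x (e i) = fderiv ℝ ξ x x := by
      have h := congrArg (fderiv ℝ ξ x) ((EuclideanSpace.basisFun (Fin N) ℝ).sum_repr x)
      rw [map_sum] at h
      rw [← h]
      simp [he]
    have hU : ∀ i, fderiv ℝ (fun x => u x * Γ x) x (e i) = F i x +
        2 * τ / ‖x‖ ^ 2 * (u x * Γ x) * x i := fun i => by
      rw [fderiv_fun_mul (hdiff hu1 x hx) (hdiff hΓ1 x hx)]
      have h5 := fderiv_comp_norm hx (hasDerivAt_rpow_left (τ := τ) hr) (e i)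
      rw [inner_single_one, Real.rpow_sub hr, Real.rpow_one] at h5
      have h6 : fderiv ℝ Γ x (e i) = τ * Γ x / ‖x‖ ^ 2 * x i := by
        rw [hΓ, h5]
        field_simp
      simp only [hF, FunLike.coe_add, Pi.add_apply, FunLike.coe_smul, Pi.smul_apply, smul_eq_mul,
        h6]
      ring
    simp only [hU, Finset.sum_sub_distrib, Finset.sum_add_distrib, add_mul, ← Finset.sum_mul,
      hdiv x hx, ← Finset.mul_sum, mul_assoc, hsum]
    change u x * (LstarMuV N μ V ξ x * Γ x) =
      _ - (u x * (Γ x * lap ξ x) + _)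
    rw [LstarMuV, LstarMu, ← hτ]
    ring
  have hI : ∀ i ∈ Finset.univ, Integrable (fun x =>
      ((F i x * fderiv ℝ ξ x (e i) + fderiv ℝ (F i) x (e i) * ξ x) -
      (u x * Γ x * fderiv ℝ (fun y => fderiv ℝ ξ y (e i)) x (e i) +
        fderiv ℝ (fun x => u x * Γ x) x (e i) * fderiv ℝ ξ x (e i)))) := fun i _ =>
    ((I2 i).1.add (I2 i).2.1).sub ((I1 i).1.add (I1 i).2.1)
  refine ⟨(integrable_finsetSum _ hI).congr key.symm, ?_⟩
  rw [integral_congr_ae key, integral_finsetSum _ hI]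
  refine Finset.sum_eq_zero fun i _ => ?_
  refine (integral_sub ((I2 i).1.add (I2 i).2.1) ((I1 i).1.add (I1 i).2.1)).trans ?_
  rw [integral_add' (I2 i).1 (I2 i).2.1, integral_add' (I1 i).1 (I1 i).2.1, (I1 i).2.2,
    (I2 i).2.2]
  ring

/-- `φ'` and `φ''` are the first two derivatives of `φ` on `(0, ∞)`, and `φ''` is continuous. -/
structure HasTwoDerivs (φ φ' φ'' : ℝ → ℝ) : Prop where
  hasDerivAt : ∀ r, 0 < r → HasDerivAt φ (φ' r) r
  hasDerivAt' : ∀ r, 0 < r → HasDerivAt φ' (φ'' r) r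
  continuousOn : ContinuousOn φ'' (Set.Ioi 0)

namespace HasTwoDerivs

variable {φ φ' φ'' ψ ψ' ψ'' : ℝ → ℝ}

theorem continuousOn_fun (h : HasTwoDerivs φ φ' φ'') : ContinuousOn φ (Set.Ioi 0) :=
  fun r hr => (h.hasDerivAt r hr).continuousAt.continuousWithinAt

theorem continuousOn_deriv (h : HasTwoDerivs φ φ' φ'') : ContinuousOn φ' (Set.Ioi 0) :=
  fun r hr => (h.hasDerivAt' r hr).continuousAt.continuousWithinAt

theorem mul (h : HasTwoDerivs φ φ' φ'') (k : HasTwoDerivs ψ ψ' ψ'') :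
    HasTwoDerivs (fun r => φ r * ψ r) (fun r => φ' r * ψ r + φ r * ψ' r)
      (fun r => φ'' r * ψ r + 2 * φ' r * ψ' r + φ r * ψ'' r) where
  hasDerivAt r hr := (h.hasDerivAt r hr).fun_mul (k.hasDerivAt r hr)
  hasDerivAt' r hr := by
    have := ((h.hasDerivAt' r hr).fun_mul (k.hasDerivAt r hr)).fun_add
      ((h.hasDerivAt r hr).fun_mul (k.hasDerivAt' r hr))
    exact this.congr_deriv (by ring)
  continuousOn := ((h.continuousOn.mul k.continuousOn_fun).add
    ((continuousOn_const.mul h.continuousOn_deriv).mul k.continuousOn_deriv)).add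
    (h.continuousOn_fun.mul k.continuousOn)

theorem congr_fun (h : HasTwoDerivs φ φ' φ'') (hψ : ∀ r, 0 < r → ψ r = φ r) :
    HasTwoDerivs ψ φ' φ'' where
  hasDerivAt r hr := (h.hasDerivAt r hr).congr_of_eventuallyEq (by
    filter_upwards [Ioi_mem_nhds hr] with t ht using hψ t ht)
  hasDerivAt' := h.hasDerivAt'
  continuousOn := h.continuousOn

theorem contDiffOn (h : HasTwoDerivs φ φ' φ'') : ContDiffOn ℝ 2 φ (Set.Ioi 0) := by
  have h1 : ContDiffOn ℝ 1 φ' (Set.Ioi 0) := by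
    rw [show (1 : WithTop ℕ∞) = 0 + 1 from (zero_add 1).symm,
      contDiffOn_succ_iff_deriv_of_isOpen isOpen_Ioi]
    refine ⟨fun r hr => (h.hasDerivAt' r hr).differentiableAt.differentiableWithinAt, by simp, ?_⟩
    rw [contDiffOn_zero]
    exact h.continuousOn.congr fun r hr => (h.hasDerivAt' r hr).deriv
  rw [show (2 : WithTop ℕ∞) = 1 + 1 from one_add_one_eq_two.symm,
    contDiffOn_succ_iff_deriv_of_isOpen isOpen_Ioi]
  refine ⟨fun r hr => (h.hasDerivAt r hr).differentiableAt.differentiableWithinAt, by simp, ?_⟩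
  exact h1.congr fun r hr => (h.hasDerivAt r hr).deriv

/-- A radial function with `C²` profile, constant near the origin, is `C²`. -/
theorem contDiff_comp_norm {N : ℕ} {a c : ℝ} (h : HasTwoDerivs φ φ' φ'') (ha : 0 < a)
    (hc : ∀ r, r < a → φ r = c) : ContDiff ℝ 2 (fun x : Euc N => φ ‖x‖) := by
  rw [contDiff_iff_contDiffAt]
  intro x
  by_cases hx : x = 0
  · subst hx
    refine (contDiffAt_const (c := c)).congr_of_eventuallyEq ?_
    filter_upwards [ball_mem_nhds (0 : Euc N) ha] with y hy
    exact hc _ (by simpa using hy)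
  · exact (h.contDiffOn.contDiffAt (Ioi_mem_nhds (norm_pos_iff.2 hx))).comp x
      (contDiffAt_norm ℝ hx)

end HasTwoDerivs

theorem hasCompactSupport_comp_norm {N : ℕ} {φ : ℝ → ℝ} {R : ℝ} (hR : ∀ r, R < r → φ r = 0) :
    HasCompactSupport (fun x : Euc N => φ ‖x‖) :=
  HasCompactSupport.intro (isCompact_closedBall (0 : Euc N) R) fun x hx =>
    hR _ (by simpa using hx)

/-- The radial case of the identity tested against functions vanishing near the origin. -/
def RadialTestIdentity (N : ℕ) (μ : ℝ) (w W : Euc N → ℝ) : Prop :=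
  ∀ ⦃φ φ' φ'' : ℝ → ℝ⦄ ⦃a R : ℝ⦄, HasTwoDerivs φ φ' φ'' → 0 < a → (∀ r, r < a → φ r = 0) →
    (∀ r, R < r → φ r = 0) →
    Integrable (fun x => w x *
      (radialOp N μ (φ' ‖x‖) (φ'' ‖x‖) ‖x‖ - μ * W x * φ ‖x‖)) ∧
    ∫ x, w x * (radialOp N μ (φ' ‖x‖) (φ'' ‖x‖) ‖x‖ - μ * W x * φ ‖x‖) = 0

theorem radialTestIdentity {N : ℕ} (hN : 3 ≤ N) {μ : ℝ} (hμ0 : μ ≤ mu0 N)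
    {V u : Euc N → ℝ} (hu : IsSolution N μ V u) :
    RadialTestIdentity N μ (fun x => u x * ‖x‖ ^ tauPlus N μ)
      (fun x => V x - ‖x‖ ^ (-2 : ℝ)) := by
  intro φ φ' φ'' a R h ha h0 hR
  have : NeZero N := ⟨by omega⟩
  have key := integral_mul_LstarMuV_of_vanish_near_zero hN hμ0 hu
    (IsC11c.of_contDiff (h.contDiff_comp_norm ha h0) (hasCompactSupport_comp_norm hR)) (by
      filter_upwards [ball_mem_nhds (0 : Euc N) ha] with y hy
      exact h0 _ (by simpa using hy))
  have e : (fun x => u x * LstarMuV N μ V (fun x : Euc N => φ ‖x‖) x * ‖x‖ ^ tauPlus N μ)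
      =ᵐ[volume] (fun x => u x * ‖x‖ ^ tauPlus N μ *
      (radialOp N μ (φ' ‖x‖) (φ'' ‖x‖) ‖x‖ - μ * (V x - ‖x‖ ^ (-2 : ℝ)) * φ ‖x‖)) := by
    have hae : ∀ᵐ x : Euc N, x ≠ 0 := by
      simp [ae_iff]
    filter_upwards [hae] with x hx
    rw [LstarMuV, LstarMu_comp_norm h.hasDerivAt h.hasDerivAt' hx]
    ring
  exact ⟨key.1.congr e, (integral_congr_ae e).symm.trans key.2⟩

/-- The primitive of the smooth transition function: a convex smooth ramp. -/
def softRamp (y : ℝ) : ℝ := ∫ t in (0 : ℝ)..y, Real.smoothTransition t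

theorem hasDerivAt_softRamp (y : ℝ) : HasDerivAt softRamp (Real.smoothTransition y) y :=
  intervalIntegral.integral_hasDerivAt_right
    (Real.smoothTransition.continuous.intervalIntegrable _ _)
    (Real.smoothTransition.continuous.stronglyMeasurableAtFilter _ _)
    Real.smoothTransition.continuousAt

theorem softRamp_of_nonpos {y : ℝ} (hy : y ≤ 0) : softRamp y = 0 := by
  rw [softRamp, intervalIntegral.integral_congr (g := fun _ => (0 : ℝ)), intervalIntegral.integral_zero]
  intro t ht
  rw [Set.uIcc_of_ge hy] at ht
  exact Real.smoothTransition.zero_of_nonpos ht.2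

theorem softRamp_nonneg (y : ℝ) : 0 ≤ softRamp y := by
  rcases le_total y 0 with hy | hy
  · rw [softRamp_of_nonpos hy]
  · exact intervalIntegral.integral_nonneg hy fun t _ => Real.smoothTransition.nonneg t

theorem softRamp_of_one_le {y : ℝ} (hy : 1 ≤ y) : softRamp y = y - (1 - softRamp 1) := by
  have h : ∫ t in (1 : ℝ)..y, Real.smoothTransition t = y - 1 := by
    rw [intervalIntegral.integral_congr (g := fun _ => (1 : ℝ))]
    · simp
    · intro t ht
      rw [Set.uIcc_of_le hy] at ht
      exact Real.smoothTransition.one_of_one_le ht.1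
  have := intervalIntegral.integral_add_adjacent_intervals
    (Real.smoothTransition.continuous.intervalIntegrable (μ := volume) 0 1)
    (Real.smoothTransition.continuous.intervalIntegrable (μ := volume) 1 y)
  rw [h] at this
  unfold softRamp
  linarith

theorem hasDerivAt_smoothTransition (y : ℝ) :
    HasDerivAt Real.smoothTransition (deriv Real.smoothTransition y) y :=
  ((Real.smoothTransition.contDiff (n := 1)).differentiable (by norm_num) y).hasDerivAt

theorem contDiff_deriv_smoothTransition : ContDiff ℝ 1 (deriv Real.smoothTransition) := by
  have h : ContDiff ℝ (1 + 1) Real.smoothTransition := Real.smoothTransition.contDiff (n := 2)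
  exact (contDiff_succ_iff_deriv.1 h).2.2

theorem hasDerivAt_deriv_smoothTransition (y : ℝ) :
    HasDerivAt (deriv Real.smoothTransition) (deriv (deriv Real.smoothTransition) y) y :=
  (contDiff_deriv_smoothTransition.differentiable one_ne_zero y).hasDerivAt

theorem continuous_deriv_smoothTransition : Continuous (deriv Real.smoothTransition) :=
  contDiff_deriv_smoothTransition.continuous

theorem continuous_deriv_deriv_smoothTransition :
    Continuous (deriv (deriv Real.smoothTransition)) :=
  contDiff_deriv_smoothTransition.continuous_deriv le_rfl

theorem deriv_smoothTransition_nonneg (y : ℝ) : 0 ≤ deriv Real.smoothTransition y :=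
  Real.smoothTransition.monotone.deriv_nonneg

theorem deriv_smoothTransition_of_one_lt {y : ℝ} (hy : 1 < y) :
    deriv Real.smoothTransition y = 0 ∧ deriv (deriv Real.smoothTransition) y = 0 := by
  have h : ∀ z, 1 < z → deriv Real.smoothTransition z = 0 := fun z hz => by
    have : Real.smoothTransition =ᶠ[𝓝 z] fun _ => 1 := by
      filter_upwards [Ioi_mem_nhds hz] with t ht
      exact Real.smoothTransition.one_of_one_le (le_of_lt ht)
    rw [this.deriv_eq, deriv_const]
  refine ⟨h y hy, ?_⟩
  have : deriv Real.smoothTransition =ᶠ[𝓝 y] fun _ => 0 := by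
    filter_upwards [Ioi_mem_nhds hy] with t ht using h t ht
  rw [this.deriv_eq, deriv_const]

theorem deriv_smoothTransition_of_neg {y : ℝ} (hy : y < 0) :
    deriv Real.smoothTransition y = 0 ∧ deriv (deriv Real.smoothTransition) y = 0 := by
  have h : ∀ z, z < 0 → deriv Real.smoothTransition z = 0 := fun z hz => by
    have : Real.smoothTransition =ᶠ[𝓝 z] fun _ => 0 := by
      filter_upwards [Iio_mem_nhds hz] with t ht
      exact Real.smoothTransition.zero_of_nonpos (le_of_lt ht)
    rw [this.deriv_eq, deriv_const]
  refine ⟨h y hy, ?_⟩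
  have : deriv Real.smoothTransition =ᶠ[𝓝 y] fun _ => 0 := by
    filter_upwards [Iio_mem_nhds hy] with t ht using h t ht
  rw [this.deriv_eq, deriv_const]

theorem hasTwoDerivs_smoothTransition_affine (c d : ℝ) :
    HasTwoDerivs (fun r => Real.smoothTransition (c * r + d))
      (fun r => c * deriv Real.smoothTransition (c * r + d))
      (fun r => c ^ 2 * deriv (deriv Real.smoothTransition) (c * r + d)) := by
  have ha : ∀ r, HasDerivAt (fun r => c * r + d) c r := fun r => by
    simpa using ((hasDerivAt_id' r).const_mul c).add_const d
  refine ⟨fun r _ => ?_, fun r _ => ?_, ?_⟩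
  · exact ((hasDerivAt_smoothTransition _).comp r (ha r)).congr_deriv (by ring)
  · exact (((hasDerivAt_deriv_smoothTransition _).comp r (ha r)).const_mul c).congr_deriv (by ring)
  · exact (continuous_const.mul (continuous_deriv_deriv_smoothTransition.comp
      (by fun_prop))).continuousOn

theorem hasTwoDerivs_softRamp_affine (c d : ℝ) :
    HasTwoDerivs (fun r => softRamp (c * r + d))
      (fun r => c * Real.smoothTransition (c * r + d))
      (fun r => c ^ 2 * deriv Real.smoothTransition (c * r + d)) := by
  have ha : ∀ r, HasDerivAt (fun r => c * r + d) c r := fun r => by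
    simpa using ((hasDerivAt_id' r).const_mul c).add_const d
  refine ⟨fun r _ => ?_, fun r _ => ?_, ?_⟩
  · exact ((hasDerivAt_softRamp _).comp r (ha r)).congr_deriv (by ring)
  · exact (((hasDerivAt_smoothTransition _).comp r (ha r)).const_mul c).congr_deriv (by ring)
  · exact (continuous_const.mul (continuous_deriv_smoothTransition.comp
      (by fun_prop))).continuousOn

theorem hasTwoDerivs_softRamp_log (n : ℝ) :
    HasTwoDerivs (fun r => softRamp (Real.log r + n))
      (fun r => Real.smoothTransition (Real.log r + n) / r)
      (fun r => (deriv Real.smoothTransition (Real.log r + n) -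
        Real.smoothTransition (Real.log r + n)) / r ^ 2) := by
  have ha : ∀ r, 0 < r → HasDerivAt (fun r => Real.log r + n) r⁻¹ r := fun r hr =>
    (Real.hasDerivAt_log hr.ne').add_const n
  refine ⟨fun r hr => ?_, fun r hr => ?_, ?_⟩
  · exact ((hasDerivAt_softRamp _).comp r (ha r hr)).congr_deriv (by ring)
  · refine (((hasDerivAt_smoothTransition _).comp r (ha r hr)).fun_div (hasDerivAt_id' r)
      hr.ne').congr_deriv ?_
    simp only [Function.comp_apply]
    field_simp
  · have hl : ContinuousOn (fun r => Real.log r + n) (Set.Ioi 0) := fun r hr =>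
      (ha r hr).continuousAt.continuousWithinAt
    refine ContinuousOn.div ?_ (by fun_prop) fun r hr => pow_ne_zero 2 (ne_of_gt hr)
    exact (continuous_deriv_smoothTransition.comp_continuousOn hl).sub
      (Real.smoothTransition.continuous.comp_continuousOn hl)

theorem hasTwoDerivs_id : HasTwoDerivs (fun r => r) (fun _ => 1) (fun _ => 0) :=
  ⟨fun r _ => hasDerivAt_id' r, fun r _ => hasDerivAt_const r 1, continuousOn_const⟩

theorem hasTwoDerivs_log : HasTwoDerivs Real.log (fun r => r⁻¹) (fun r => -(r ^ 2)⁻¹) :=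
  ⟨fun _ hr => Real.hasDerivAt_log hr.ne', fun _ hr => hasDerivAt_inv hr.ne',
    (ContinuousOn.inv₀ (by fun_prop) fun _ hr => pow_ne_zero 2 (ne_of_gt hr)).neg⟩

/-- A consequence of Fatou's lemma for Bochner integrals. -/
theorem integrable_and_integral_le_of_tendsto {α : Type*} [MeasurableSpace α] {ν : Measure α}
    {f : ℕ → α → ℝ} {g : α → ℝ} {C : ℕ → ℝ} {c : ℝ} (hf0 : ∀ n, 0 ≤ᵐ[ν] f n)
    (hfi : ∀ n, Integrable (f n) ν) (hfC : ∀ n, ∫ x, f n x ∂ν ≤ C n)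
    (hC : Tendsto C atTop (𝓝 c))
    (hlim : ∀ᵐ x ∂ν, Tendsto (fun n => f n x) atTop (𝓝 (g x))) :
    Integrable g ν ∧ ∫ x, g x ∂ν ≤ c := by
  have hg0 : 0 ≤ᵐ[ν] g := by
    filter_upwards [hlim, ae_all_iff.2 hf0] with x hx h0
    exact ge_of_tendsto' hx h0
  have hgm : AEStronglyMeasurable g ν :=
    aestronglyMeasurable_of_tendsto_ae _ (fun n => (hfi n).aestronglyMeasurable) hlim
  have hc : 0 ≤ c := ge_of_tendsto' hC fun n => (integral_nonneg_of_ae (hf0 n)).trans (hfC n)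
  have hle : ∫⁻ x, ENNReal.ofReal (g x) ∂ν ≤ ENNReal.ofReal c := by
    calc ∫⁻ x, ENNReal.ofReal (g x) ∂ν
        = ∫⁻ x, liminf (fun n => ENNReal.ofReal (f n x)) atTop ∂ν := by
          refine lintegral_congr_ae ?_
          filter_upwards [hlim] with x hx
          exact ((ENNReal.continuous_ofReal.tendsto _).comp hx).liminf_eq.symm
      _ ≤ liminf (fun n => ∫⁻ x, ENNReal.ofReal (f n x) ∂ν) atTop :=
          lintegral_liminf_le' fun n => (hfi n).aestronglyMeasurable.aemeasurable.ennreal_ofReal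
      _ ≤ liminf (fun n => ENNReal.ofReal (C n)) atTop := by
          refine liminf_le_liminf (Eventually.of_forall fun n => ?_)
          rw [← ofReal_integral_eq_lintegral_ofReal (hfi n) (hf0 n)]
          exact ENNReal.ofReal_le_ofReal (hfC n)
      _ = ENNReal.ofReal c := ((ENNReal.continuous_ofReal.tendsto _).comp hC).liminf_eq
  refine ⟨⟨hgm, ?_⟩, ?_⟩
  · rw [hasFiniteIntegral_iff_ofReal hg0]
    exact hle.trans_lt ENNReal.ofReal_lt_top
  · rw [integral_eq_lintegral_of_nonneg_ae hg0 hgm]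
    exact ENNReal.toReal_le_of_le_ofReal hc hle

theorem integrableOn_le_norm_of_continuousOn {N : ℕ} {f : Euc N → ℝ} {a R : ℝ}
    (hf : ContinuousOn f {x | x ≠ 0}) (ha : 0 < a) (hR : ∀ x, R < ‖x‖ → f x = 0) :
    IntegrableOn f {x | a ≤ ‖x‖} := by
  have hK : IsCompact ({x : Euc N | a ≤ ‖x‖} ∩ closedBall 0 R) :=
    (isCompact_closedBall (0 : Euc N) R).inter_left (isClosed_le continuous_const continuous_norm)
  have hi : IntegrableOn f ({x : Euc N | a ≤ ‖x‖} ∩ closedBall 0 R) :=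
    (hf.mono fun x hx => norm_pos_iff.1 (ha.trans_le hx.1)).integrableOn_compact hK
  refine hi.of_forall_sdiff_eq_zero
    (isClosed_le continuous_const continuous_norm).measurableSet fun x hx => hR x ?_
  by_contra h
  exact hx.2 ⟨hx.1, by simpa using h⟩

/-- A radial cutoff, equal to `1` on `[0, δ)` and to `0` on `(2δ, ∞)`. -/
structure IsRadialCutoff (δ : ℝ) (χ χ' χ'' : ℝ → ℝ) : Prop where
  hasTwoDerivs : HasTwoDerivs χ χ' χ''
  eq_one : ∀ r, r < δ → χ r = 1 ∧ χ' r = 0 ∧ χ'' r = 0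
  eq_zero : ∀ r, 2 * δ < r → χ r = 0 ∧ χ' r = 0 ∧ χ'' r = 0
  nonneg : ∀ r, 0 ≤ χ r

theorem exists_isRadialCutoff {δ : ℝ} (hδ : 0 < δ) : ∃ χ χ' χ'', IsRadialCutoff δ χ χ' χ'' := by
  refine ⟨_, _, _, hasTwoDerivs_smoothTransition_affine (-δ⁻¹) 2, fun r hr => ?_, fun r hr => ?_,
    fun r => Real.smoothTransition.nonneg _⟩
  · have h : 1 < -δ⁻¹ * r + 2 := by
      have : δ⁻¹ * r < 1 := by rwa [inv_mul_lt_iff₀ hδ, mul_one]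
      linarith
    obtain ⟨h1, h2⟩ := deriv_smoothTransition_of_one_lt h
    rw [h1, h2, mul_zero, mul_zero]
    exact ⟨Real.smoothTransition.one_of_one_le h.le, rfl, rfl⟩
  · have h : -δ⁻¹ * r + 2 < 0 := by
      have : 2 < δ⁻¹ * r := by
        rw [lt_inv_mul_iff₀ hδ]
        linarith
      linarith
    obtain ⟨h1, h2⟩ := deriv_smoothTransition_of_neg h
    rw [h1, h2, mul_zero, mul_zero]
    exact ⟨Real.smoothTransition.zero_of_nonpos h.le, rfl, rfl⟩

theorem HasTwoDerivs.continuousOn_radialOp {N : ℕ} {μ : ℝ} {φ φ' φ'' : ℝ → ℝ}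
    (h : HasTwoDerivs φ φ' φ'') :
    ContinuousOn (fun x : Euc N => radialOp N μ (φ' ‖x‖) (φ'' ‖x‖) ‖x‖) {x | x ≠ 0} := by
  have hm : Set.MapsTo (fun x : Euc N => ‖x‖) {x | x ≠ 0} (Set.Ioi 0) :=
    fun x hx => norm_pos_iff.2 hx
  have h1 := h.continuousOn_deriv.comp continuous_norm.continuousOn hm
  have h2 := h.continuousOn.comp continuous_norm.continuousOn hm
  exact (h2.add ((continuousOn_const.div continuous_norm.continuousOn
    fun x hx => norm_ne_zero_iff.2 hx).mul h1)).neg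

section Cutoff

variable {N : ℕ} {μ δ : ℝ} {w W : Euc N → ℝ} {χ χ' χ'' h h' h'' k k' k'' : ℝ → ℝ}

/-- The integral of `w L*_μ(χ k)` over the complement of the ball of radius `δ`. -/
def outerFlux (N : ℕ) (μ δ : ℝ) (w : Euc N → ℝ) (χ χ' χ'' k k' k'' : ℝ → ℝ) : ℝ :=
  ∫ x in (ball (0 : Euc N) δ)ᶜ, w x * radialOp N μ (χ' ‖x‖ * k ‖x‖ + χ ‖x‖ * k' ‖x‖)
    (χ'' ‖x‖ * k ‖x‖ + 2 * χ' ‖x‖ * k' ‖x‖ + χ ‖x‖ * k'' ‖x‖) ‖x‖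

theorem IsRadialCutoff.integrableOn_outer (hχ : IsRadialCutoff δ χ χ' χ'') (hδ : 0 < δ)
    (hw : ContinuousOn w {x | x ≠ 0}) (hk : HasTwoDerivs k k' k'') :
    IntegrableOn (fun x : Euc N => w x * radialOp N μ (χ' ‖x‖ * k ‖x‖ + χ ‖x‖ * k' ‖x‖)
      (χ'' ‖x‖ * k ‖x‖ + 2 * χ' ‖x‖ * k' ‖x‖ + χ ‖x‖ * k'' ‖x‖) ‖x‖) (ball 0 δ)ᶜ := by
  have : (ball (0 : Euc N) δ)ᶜ = {x | δ ≤ ‖x‖} := by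
    ext x
    simp
  rw [this]
  refine integrableOn_le_norm_of_continuousOn (R := 2 * δ)
    (hw.mul (hχ.hasTwoDerivs.mul hk).continuousOn_radialOp) hδ fun x hx => ?_
  obtain ⟨h1, h2, h3⟩ := hχ.eq_zero _ hx
  simp [h1, h2, h3, radialOp]

/-- Testing against `χ h`, where `h` vanishes near the origin and agrees with `b k + q` away from
the ball of radius `δ`. -/
theorem RadialTestIdentity.cutoff (hid : RadialTestIdentity N μ w W)
    (hw : ContinuousOn w {x | x ≠ 0}) (hW : ContinuousOn W {x | x ≠ 0}) (hδ : 0 < δ)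
    (hχ : IsRadialCutoff δ χ χ' χ'') (hh : HasTwoDerivs h h' h'') (hk : HasTwoDerivs k k' k'')
    {b q ε : ℝ} (hε : 0 < ε) (h0 : ∀ r, r < ε → h r = 0)
    (hbk : ∀ r, δ ≤ r → h r = b * k r + q ∧ h' r = b * k' r ∧ h'' r = b * k'' r) :
    IntegrableOn (fun x => w x * -radialOp N μ (h' ‖x‖) (h'' ‖x‖) ‖x‖) (ball 0 δ) ∧
    Integrable (fun x => w x * W x * (χ ‖x‖ * h ‖x‖)) ∧
    (∫ x in ball 0 δ, w x * -radialOp N μ (h' ‖x‖) (h'' ‖x‖) ‖x‖) +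
      μ * ∫ x, w x * W x * (χ ‖x‖ * h ‖x‖) =
      b * outerFlux N μ δ w χ χ' χ'' k k' k'' +
        q * outerFlux N μ δ w χ χ' χ'' (fun _ => 1) (fun _ => 0) (fun _ => 0) := by
  have hφ := hχ.hasTwoDerivs.mul hh
  set φ : ℝ → ℝ := fun r => χ r * h r with hφd
  set φ' : ℝ → ℝ := fun r => χ' r * h r + χ r * h' r
  set φ'' : ℝ → ℝ := fun r => χ'' r * h r + 2 * χ' r * h' r + χ r * h'' r
  obtain ⟨hI, hI0⟩ := hid (R := 2 * δ) hφ hε (fun r hr => by simp [hφd, h0 r hr])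
    (fun r hr => by simp [hφd, (hχ.eq_zero r hr).1])
  have hm : Set.MapsTo (fun x : Euc N => ‖x‖) {x | x ≠ 0} (Set.Ioi 0) :=
    fun x hx => norm_pos_iff.2 hx
  have hWi : Integrable (fun x => w x * W x * φ ‖x‖) := by
    have h1 : IntegrableOn (fun x => w x * W x * φ ‖x‖) {x : Euc N | ε ≤ ‖x‖} := by
      refine integrableOn_le_norm_of_continuousOn (R := 2 * δ) ((hw.mul hW).mul
        (hφ.continuousOn_fun.comp continuous_norm.continuousOn hm)) hε fun x hx => ?_
      simp [hφd, (hχ.eq_zero _ hx).1]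
    refine h1.integrable_of_ae_notMem_eq_zero (ae_of_all _ fun x hx => ?_)
    have hx' : ‖x‖ < ε := by simpa using hx
    simp [hφd, h0 _ hx']
  have hLi : Integrable (fun x => w x * radialOp N μ (φ' ‖x‖) (φ'' ‖x‖) ‖x‖) := by
    refine (hI.add (hWi.const_mul μ)).congr (ae_of_all _ fun x => ?_)
    simp only [Pi.add_apply]
    ring
  have e0 : (∫ x, w x * radialOp N μ (φ' ‖x‖) (φ'' ‖x‖) ‖x‖) =
      μ * ∫ x, w x * W x * φ ‖x‖ := by
    rw [← integral_const_mul, ← sub_eq_zero, ← integral_sub hLi (hWi.const_mul μ), ← hI0]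
    refine integral_congr_ae (ae_of_all _ fun x => ?_)
    ring
  have ein : Set.EqOn (fun x => w x * -radialOp N μ (h' ‖x‖) (h'' ‖x‖) ‖x‖)
      (fun x => -(w x * radialOp N μ (φ' ‖x‖) (φ'' ‖x‖) ‖x‖)) (ball 0 δ) := fun x hx => by
    obtain ⟨h1, h2, h3⟩ := hχ.eq_one ‖x‖ (by simpa using hx)
    simp [φ', φ'', h1, h2, h3]
  have eout : ∫ x in (ball (0 : Euc N) δ)ᶜ, w x * radialOp N μ (φ' ‖x‖) (φ'' ‖x‖) ‖x‖ =
      b * outerFlux N μ δ w χ χ' χ'' k k' k'' +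
        q * outerFlux N μ δ w χ χ' χ'' (fun _ => 1) (fun _ => 0) (fun _ => 0) := by
    rw [outerFlux, outerFlux, ← integral_const_mul, ← integral_const_mul, ← integral_add
      ((hχ.integrableOn_outer hδ hw hk).const_mul b)
      ((hχ.integrableOn_outer hδ hw ⟨fun r _ => hasDerivAt_const r 1,
        fun r _ => hasDerivAt_const r 0, continuousOn_const⟩).const_mul q)]
    refine setIntegral_congr_fun measurableSet_ball.compl fun x hx => ?_
    obtain ⟨h1, h2, h3⟩ := hbk ‖x‖ (by simpa using hx)
    simp only [φ', φ'', h1, h2, h3, radialOp]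
    ring
  refine ⟨hLi.neg.integrableOn.congr_fun ein.symm measurableSet_ball, hWi, ?_⟩
  rw [setIntegral_congr_fun measurableSet_ball ein, integral_neg, ← eout, ← e0,
    ← integral_add_compl measurableSet_ball hLi]
  ring

theorem ae_ne_zero {N : ℕ} (hN : 3 ≤ N) : ∀ᵐ x : Euc N, x ≠ 0 := by
  have : NeZero N := ⟨by omega⟩
  simp [ae_iff]

/-- One-sided consequences of the cutoff identity when `-radialOp` is nonnegative. -/
theorem RadialTestIdentity.cutoff_le (hid : RadialTestIdentity N μ w W) (hN : 3 ≤ N) (hμ : 0 ≤ μ)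
    (hw : ContinuousOn w {x | x ≠ 0}) (hW : ContinuousOn W {x | x ≠ 0}) (hδ : 0 < δ)
    (hw0 : ∀ x, x ≠ 0 → ‖x‖ ≤ 2 * δ → 0 ≤ w x) (hW0 : ∀ x, x ≠ 0 → 0 ≤ W x)
    (hχ : IsRadialCutoff δ χ χ' χ'') (hh : HasTwoDerivs h h' h'') (hk : HasTwoDerivs k k' k'')
    {b q ε : ℝ} (hε : 0 < ε) (h0 : ∀ r, r < ε → h r = 0)
    (hbk : ∀ r, δ ≤ r → h r = b * k r + q ∧ h' r = b * k' r ∧ h'' r = b * k'' r)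
    (hpos : ∀ r, 0 ≤ h r) (hrad : ∀ r, 0 < r → 0 ≤ -radialOp N μ (h' r) (h'' r) r) :
    0 ≤ᵐ[volume.restrict (ball 0 δ)] (fun x => w x * -radialOp N μ (h' ‖x‖) (h'' ‖x‖) ‖x‖) ∧
    0 ≤ᵐ[volume] (fun x => w x * W x * (χ ‖x‖ * h ‖x‖)) ∧
    ∫ x in ball 0 δ, w x * -radialOp N μ (h' ‖x‖) (h'' ‖x‖) ‖x‖ ≤
      b * outerFlux N μ δ w χ χ' χ'' k k' k'' +
        q * outerFlux N μ δ w χ χ' χ'' (fun _ => 1) (fun _ => 0) (fun _ => 0) ∧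
    μ * ∫ x, w x * W x * (χ ‖x‖ * h ‖x‖) ≤
      b * outerFlux N μ δ w χ χ' χ'' k k' k'' +
        q * outerFlux N μ δ w χ χ' χ'' (fun _ => 1) (fun _ => 0) (fun _ => 0) := by
  have h1 : 0 ≤ᵐ[volume.restrict (ball 0 δ)]
      (fun x => w x * -radialOp N μ (h' ‖x‖) (h'' ‖x‖) ‖x‖) := by
    filter_upwards [ae_restrict_mem measurableSet_ball, ae_restrict_of_ae (ae_ne_zero hN)]
      with x hx hx0
    have hx' : ‖x‖ < δ := by simpa using hx
    exact mul_nonneg (hw0 x hx0 (by linarith)) (hrad _ (norm_pos_iff.2 hx0))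
  have h2 : 0 ≤ᵐ[volume] (fun x => w x * W x * (χ ‖x‖ * h ‖x‖)) := by
    filter_upwards [ae_ne_zero hN] with x hx0
    rcases le_or_gt ‖x‖ (2 * δ) with hx | hx
    · exact mul_nonneg (mul_nonneg (hw0 x hx0 hx) (hW0 x hx0))
        (mul_nonneg (hχ.nonneg _) (hpos _))
    · simp [(hχ.eq_zero _ hx).1]
  have e := (hid.cutoff hw hW hδ hχ hh hk hε h0 hbk).2.2
  have i1 := integral_nonneg_of_ae h1
  have i2 := mul_nonneg hμ (integral_nonneg_of_ae h2)
  exact ⟨h1, h2, by linarith, by linarith⟩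

theorem RadialTestIdentity.integrableOn_div_norm (hid : RadialTestIdentity N μ w W) (hN : 3 ≤ N)
    (hμ : 0 ≤ μ) (hw : ContinuousOn w {x | x ≠ 0}) (hW : ContinuousOn W {x | x ≠ 0})
    (hδ : 0 < δ) (hw0 : ∀ x, x ≠ 0 → ‖x‖ ≤ 2 * δ → 0 ≤ w x) (hW0 : ∀ x, x ≠ 0 → 0 ≤ W x)
    (hχ : IsRadialCutoff δ χ χ' χ'') :
    IntegrableOn (fun x => w x / ‖x‖) (ball 0 δ) := by
  set s := Real.sqrt (mu0 N - μ)
  have hs : 0 ≤ s := Real.sqrt_nonneg _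
  set A := outerFlux N μ δ w χ χ' χ'' (fun _ => 1) (fun _ => 0) (fun _ => 0)
  set B := outerFlux N μ δ w χ χ' χ'' (fun r => r) (fun _ => 1) (fun _ => 0)
  obtain ⟨m, hm⟩ := exists_nat_ge (max 1 (3 * δ⁻¹))
  have hm1 : (1 : ℝ) ≤ m := (le_max_left _ _).trans hm
  have hm2 : 3 * δ⁻¹ ≤ m := (le_max_right _ _).trans hm
  set ν : ℕ → ℝ := fun n => n + m
  have hνm : ∀ n, m ≤ ν n := fun n => by simp [ν]
  have hν0 : ∀ n, 0 < ν n := fun n => by linarith [hνm n]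
  have hνδ : ∀ n r, δ ≤ r → 1 < ν n * r + -1 := fun n r hr => by
    have : 3 ≤ ν n * r := by
      calc 3 = 3 * δ⁻¹ * δ := by field_simp
        _ ≤ ν n * r := mul_le_mul (hm2.trans (hνm n)) hr hδ.le (hν0 n).le
    linarith
  have hνt : Tendsto ν atTop atTop :=
    tendsto_atTop_add_const_right _ _ tendsto_natCast_atTop_atTop
  set q := -(1 + (1 - softRamp 1))
  have h0 : ∀ n r, r < (ν n)⁻¹ → softRamp (ν n * r + -1) = 0 := fun n r hr => by
    refine softRamp_of_nonpos ?_
    have := (mul_lt_mul_of_pos_left hr (hν0 n)).le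
    rw [mul_inv_cancel₀ (hν0 n).ne'] at this
    linarith
  have hbk : ∀ n r, δ ≤ r → softRamp (ν n * r + -1) = ν n * r + q ∧
      ν n * Real.smoothTransition (ν n * r + -1) = ν n * 1 ∧
      ν n ^ 2 * deriv Real.smoothTransition (ν n * r + -1) = ν n * 0 := fun n r hr => by
    have h1 := hνδ n r hr
    rw [softRamp_of_one_le h1.le, Real.smoothTransition.one_of_one_le h1.le,
      (deriv_smoothTransition_of_one_lt h1).1]
    refine ⟨?_, rfl, by ring⟩
    simp only [q]
    ring
  have hrad : ∀ n r, 0 < r → 0 ≤ -radialOp N μ (ν n * Real.smoothTransition (ν n * r + -1))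
      (ν n ^ 2 * deriv Real.smoothTransition (ν n * r + -1)) r := fun n r hr => by
    have h1 := deriv_smoothTransition_nonneg (ν n * r + -1)
    have h2 := Real.smoothTransition.nonneg (ν n * r + -1)
    have h3 := hν0 n
    rw [radialOp, neg_neg]
    positivity
  have key := fun n => hid.cutoff_le hN hμ hw hW hδ hw0 hW0 hχ
    (hasTwoDerivs_softRamp_affine (ν n) (-1)) hasTwoDerivs_id (inv_pos.2 (hν0 n)) (h0 n) (hbk n)
    (fun r => softRamp_nonneg _) (hrad n)
  have hint := fun n => (hid.cutoff hw hW hδ hχ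
    (hasTwoDerivs_softRamp_affine (ν n) (-1)) hasTwoDerivs_id (inv_pos.2 (hν0 n)) (h0 n) (hbk n)).1
  have main := (integrable_and_integral_le_of_tendsto (ν := volume.restrict (ball 0 δ))
    (f := fun n x => (ν n)⁻¹ * (w x * -radialOp N μ (ν n * Real.smoothTransition (ν n * ‖x‖ + -1))
      (ν n ^ 2 * deriv Real.smoothTransition (ν n * ‖x‖ + -1)) ‖x‖))
    (g := fun x => (1 + 2 * s) * (w x / ‖x‖)) (C := fun n => B + q * A * (ν n)⁻¹) (c := B)
    (fun n => ?_) (fun n => (hint n).const_mul _) (fun n => ?_) ?_ ?_).1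
  · refine (main.const_mul (1 + 2 * s)⁻¹).congr (ae_of_all _ fun x => ?_)
    exact inv_mul_cancel_left₀ (by positivity) _
  · filter_upwards [(key n).1] with x hx
    exact mul_nonneg (inv_nonneg.2 (hν0 n).le) hx
  · rw [integral_const_mul, inv_mul_le_iff₀ (hν0 n)]
    refine (key n).2.2.1.trans (le_of_eq ?_)
    have := (hν0 n).ne'
    simp only [A, B]
    field_simp
  · simpa using (tendsto_const_nhds (x := B)).add
      ((tendsto_inv_atTop_zero.comp hνt).const_mul (q * A))
  · filter_upwards [ae_restrict_of_ae (ae_ne_zero hN)] with x hx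
    have hx' : 0 < ‖x‖ := norm_pos_iff.2 hx
    refine tendsto_const_nhds.congr' ?_
    filter_upwards [hνt.eventually_gt_atTop (2 / ‖x‖)] with n hn
    have h1 : 1 < ν n * ‖x‖ + -1 := by
      rw [div_lt_iff₀ hx'] at hn
      linarith
    have := (hν0 n).ne'
    rw [Real.smoothTransition.one_of_one_le h1.le, (deriv_smoothTransition_of_one_lt h1).1,
      radialOp]
    field_simp
    ring

theorem RadialTestIdentity.integrable_mul_cutoff (hid : RadialTestIdentity N μ w W) (hN : 3 ≤ N)
    (hμ : 0 < μ) (hw : ContinuousOn w {x | x ≠ 0}) (hW : ContinuousOn W {x | x ≠ 0})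
    (hδ : 0 < δ) (hw0 : ∀ x, x ≠ 0 → ‖x‖ ≤ 2 * δ → 0 ≤ w x) (hW0 : ∀ x, x ≠ 0 → 0 ≤ W x)
    (hχ : IsRadialCutoff δ χ χ' χ'') :
    Integrable (fun x => w x * W x * χ ‖x‖) ∧
      μ * ∫ x, w x * W x * χ ‖x‖ ≤
        outerFlux N μ δ w χ χ' χ'' (fun _ => 1) (fun _ => 0) (fun _ => 0) := by
  set s := Real.sqrt (mu0 N - μ)
  have hs : 0 ≤ s := Real.sqrt_nonneg _
  set A := outerFlux N μ δ w χ χ' χ'' (fun _ => 1) (fun _ => 0) (fun _ => 0)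
  set B := outerFlux N μ δ w χ χ' χ'' Real.log (fun r => r⁻¹) (fun r => -(r ^ 2)⁻¹)
  set a := 1 - softRamp 1
  obtain ⟨m, hm⟩ := exists_nat_gt (max (1 - Real.log δ) a)
  have hm1 : 1 - Real.log δ < m := (le_max_left _ _).trans_lt hm
  have hm2 : a < m := (le_max_right _ _).trans_lt hm
  set ν : ℕ → ℝ := fun n => n + m
  have hνm : ∀ n, m ≤ ν n := fun n => by simp [ν]
  have hν0 : ∀ n, 0 < ν n - a := fun n => by linarith [hνm n]
  have hνt : Tendsto ν atTop atTop :=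
    tendsto_atTop_add_const_right _ _ tendsto_natCast_atTop_atTop
  set h : ℕ → ℝ → ℝ := fun n r => if r ≤ 0 then 0 else softRamp (Real.log r + ν n)
  have hh : ∀ n r, 0 < r → h n r = softRamp (Real.log r + ν n) := fun n r hr =>
    if_neg hr.not_ge
  have h0 : ∀ n r, r < Real.exp (-ν n) → h n r = 0 := fun n r hr => by
    rcases le_or_gt r 0 with hr0 | hr0
    · exact if_pos hr0
    · rw [hh n r hr0]
      refine softRamp_of_nonpos ?_
      have := (Real.log_lt_iff_lt_exp hr0).2 hr
      linarith
  have hbk : ∀ n r, δ ≤ r → h n r = 1 * Real.log r + (ν n - a) ∧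
      Real.smoothTransition (Real.log r + ν n) / r = 1 * r⁻¹ ∧
      (deriv Real.smoothTransition (Real.log r + ν n) -
        Real.smoothTransition (Real.log r + ν n)) / r ^ 2 = 1 * -(r ^ 2)⁻¹ := fun n r hr => by
    have h1 : 1 < Real.log r + ν n := by
      linarith [Real.log_le_log hδ hr, hνm n]
    rw [hh n r (hδ.trans_le hr), softRamp_of_one_le h1.le,
      Real.smoothTransition.one_of_one_le h1.le, (deriv_smoothTransition_of_one_lt h1).1]
    refine ⟨?_, by ring, by ring⟩
    simp only [a]
    ring
  have hrad : ∀ n r, 0 < r → 0 ≤ -radialOp N μ (Real.smoothTransition (Real.log r + ν n) / r)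
      ((deriv Real.smoothTransition (Real.log r + ν n) -
        Real.smoothTransition (Real.log r + ν n)) / r ^ 2) r := fun n r hr => by
    have h1 := deriv_smoothTransition_nonneg (Real.log r + ν n)
    have h2 := Real.smoothTransition.nonneg (Real.log r + ν n)
    rw [radialOp, neg_neg]
    have : (deriv Real.smoothTransition (Real.log r + ν n) -
        Real.smoothTransition (Real.log r + ν n)) / r ^ 2 + (1 + 2 * s) / r *
        (Real.smoothTransition (Real.log r + ν n) / r) =
        (deriv Real.smoothTransition (Real.log r + ν n) +
          2 * s * Real.smoothTransition (Real.log r + ν n)) / r ^ 2 := by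
      field_simp
      ring
    rw [this]
    positivity
  have hpos : ∀ n r, 0 ≤ h n r := fun n r => by
    simp only [h]
    split_ifs
    exacts [le_rfl, softRamp_nonneg _]
  have hderiv := fun n => (hasTwoDerivs_softRamp_log (ν n)).congr_fun (hh n)
  have key := fun n => hid.cutoff_le hN hμ.le hw hW hδ hw0 hW0 hχ (hderiv n) hasTwoDerivs_log
    (Real.exp_pos _) (h0 n) (hbk n) (hpos n) (hrad n)
  have hint := fun n => (hid.cutoff hw hW hδ hχ (hderiv n) hasTwoDerivs_log
    (Real.exp_pos _) (h0 n) (hbk n)).2.1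
  have hνt' : Tendsto (fun n => (ν n - a)⁻¹) atTop (𝓝 0) :=
    tendsto_inv_atTop_zero.comp (tendsto_atTop_add_const_right _ (-a) hνt)
  have main := integrable_and_integral_le_of_tendsto (ν := (volume : Measure (Euc N)))
    (f := fun n x => μ * (ν n - a)⁻¹ * (w x * W x * (χ ‖x‖ * h n ‖x‖)))
    (g := fun x => μ * (w x * W x * χ ‖x‖)) (C := fun n => A + B * (ν n - a)⁻¹) (c := A)
    (fun n => ?_) (fun n => (hint n).const_mul _) (fun n => ?_) ?_ ?_
  · refine ⟨?_, ?_⟩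
    · refine (main.1.const_mul μ⁻¹).congr (ae_of_all _ fun x => ?_)
      exact inv_mul_cancel_left₀ hμ.ne' _
    · rw [← integral_const_mul]
      exact main.2
  · filter_upwards [(key n).2.1] with x hx
    exact mul_nonneg (mul_nonneg hμ.le (inv_nonneg.2 (hν0 n).le)) hx
  · rw [integral_const_mul, mul_comm μ, mul_assoc, inv_mul_le_iff₀ (hν0 n)]
    refine (key n).2.2.2.trans (le_of_eq ?_)
    have := (hν0 n).ne'
    simp only [A, B]
    field_simp
    ring
  · simpa using (tendsto_const_nhds (x := A)).add (hνt'.const_mul B)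
  · filter_upwards [ae_ne_zero hN] with x hx
    have hx' : 0 < ‖x‖ := norm_pos_iff.2 hx
    have hl : Tendsto (fun n => μ * (w x * W x * χ ‖x‖) * (1 + Real.log ‖x‖ * (ν n - a)⁻¹)) atTop
        (𝓝 (μ * (w x * W x * χ ‖x‖))) := by
      simpa using ((hνt'.const_mul (Real.log ‖x‖)).const_add 1).const_mul
        (μ * (w x * W x * χ ‖x‖))
    refine hl.congr' ?_
    filter_upwards [hνt.eventually_gt_atTop (1 - Real.log ‖x‖)] with n hn
    have h1 : 1 ≤ Real.log ‖x‖ + ν n := by linarith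
    have := (hν0 n).ne'
    rw [hh n _ hx', softRamp_of_one_le h1]
    have e : Real.log ‖x‖ + ν n - (1 - softRamp 1) = Real.log ‖x‖ + (ν n - a) := by
      simp only [a]
      ring
    rw [e]
    field_simp
    ring

end Cutoff

theorem integrableOn_closedBall_of_ball {N : ℕ} {f : Euc N → ℝ} {δ : ℝ}
    (hf : ContinuousOn f {x | x ≠ 0}) (hδ : 0 < δ) (h : IntegrableOn f (ball 0 δ)) (R : ℝ) :
    IntegrableOn f (closedBall 0 R) := by
  have hK : IsCompact ({x : Euc N | δ ≤ ‖x‖} ∩ closedBall 0 R) :=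
    (isCompact_closedBall (0 : Euc N) R).inter_left (isClosed_le continuous_const continuous_norm)
  have hi : IntegrableOn f ({x : Euc N | δ ≤ ‖x‖} ∩ closedBall 0 R) :=
    (hf.mono fun x hx => norm_pos_iff.1 (hδ.trans_le hx.1)).integrableOn_compact hK
  refine (h.union hi).mono_set fun x hx => ?_
  rcases lt_or_ge ‖x‖ δ with h | h
  · exact Or.inl (by simpa using h)
  · exact Or.inr ⟨h, hx⟩

theorem aestronglyMeasurable_of_continuousOn_ne_zero {N : ℕ} (hN : 3 ≤ N) {f : Euc N → ℝ}
    (hf : ContinuousOn f {x | x ≠ 0}) : AEStronglyMeasurable f volume := by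
  have h := hf.aestronglyMeasurable (μ := volume) (isOpen_ne (x := (0 : Euc N))).measurableSet
  rwa [Measure.restrict_eq_self_of_ae_mem (s := {x : Euc N | x ≠ 0}) (ae_ne_zero hN)] at h

namespace IsC11c

variable {N : ℕ} {ξ η : Euc N → ℝ}

theorem measurable_LstarMu (h : IsC11c ξ) (μ : ℝ) : Measurable (LstarMu N μ ξ) := by
  have h1 : Measurable (lap ξ) :=
    Finset.measurable_sum _ fun i _ => measurable_fderiv_apply_const ℝ _ _
  have h2 : Measurable fun x => fderiv ℝ ξ x x :=
    ((h.contDiff.continuous_fderiv one_ne_zero).clm_apply continuous_id).measurable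
  exact h1.neg.sub ((measurable_const.div (measurable_norm.pow_const 2)).mul h2)

theorem exists_norm_fderiv_le (h : IsC11c ξ) : ∃ C, 0 ≤ C ∧ ∀ x, ‖fderiv ℝ ξ x‖ ≤ C := by
  obtain ⟨C, hC⟩ := h.exists_lipschitzWith
  exact ⟨C, C.2, fun x => norm_fderiv_le_of_lipschitz ℝ hC⟩

theorem exists_abs_LstarMu_le (h : IsC11c ξ) (μ : ℝ) :
    ∃ C R, 0 ≤ C ∧ (∀ x, x ≠ 0 → |LstarMu N μ ξ x| ≤ C / ‖x‖) ∧
      ∀ x, x ∉ closedBall 0 R → LstarMu N μ ξ x = 0 ∧ ξ x = 0 := by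
  obtain ⟨R, hR0, hR⟩ := h.1.isCompact.isBounded.subset_closedBall_lt 0 (0 : Euc N)
  obtain ⟨D, hD0, hD⟩ := h.exists_norm_fderiv_le
  choose L hL using fun i => h.partial_lipschitzWith (EuclideanSpace.single i (1 : ℝ))
  have hzero : ∀ x, x ∉ closedBall 0 R → LstarMu N μ ξ x = 0 ∧ ξ x = 0 := fun x hx => by
    have hx' : ξ =ᶠ[𝓝 x] fun _ => 0 :=
      notMem_tsupport_iff_eventuallyEq.1 fun h' => hx (hR h')
    refine ⟨?_, hx'.self_of_nhds⟩
    have h2 : ∀ v, fderiv ℝ (fun y => fderiv ℝ ξ y v) x = 0 := fun v => by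
      have : (fun y => fderiv ℝ ξ y v) =ᶠ[𝓝 x] fun _ => 0 := by
        filter_upwards [hx'.fderiv (𝕜 := ℝ)] with y hy
        simp [hy]
      simp [this.fderiv_eq]
    simp [LstarMu, lap, hx'.fderiv_eq, h2]
  set S : ℝ := ∑ i, (L i : ℝ)
  have hS0 : 0 ≤ S := Finset.sum_nonneg fun i _ => (L i).2
  have hlap : ∀ x, |lap ξ x| ≤ S := fun x => by
    refine (Finset.abs_sum_le_sum_abs _ _).trans (Finset.sum_le_sum fun i _ => ?_)
    rw [← Real.norm_eq_abs]
    refine (ContinuousLinearMap.le_opNorm _ _).trans ?_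
    simpa using norm_fderiv_le_of_lipschitz ℝ (hL i)
  refine ⟨S * R + |2 * tauPlus N μ| * D, R, by positivity, fun x hx => ?_, hzero⟩
  have hx0 : 0 < ‖x‖ := norm_pos_iff.2 hx
  rcases lt_or_ge R ‖x‖ with hx1 | hx1
  · rw [(hzero x (by simpa using hx1)).1, abs_zero]
    positivity
  have h1 : |fderiv ℝ ξ x x| ≤ D * ‖x‖ :=
    (ContinuousLinearMap.le_opNorm _ _).trans (mul_le_mul_of_nonneg_right (hD x) hx0.le)
  have h2 : |2 * tauPlus N μ / ‖x‖ ^ 2 * fderiv ℝ ξ x x| ≤ |2 * tauPlus N μ| * D / ‖x‖ := by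
    rw [abs_mul, abs_div, abs_of_pos (pow_pos hx0 2)]
    calc |2 * tauPlus N μ| / ‖x‖ ^ 2 * |fderiv ℝ ξ x x|
        ≤ |2 * tauPlus N μ| / ‖x‖ ^ 2 * (D * ‖x‖) := by gcongr
      _ = _ := by field_simp
  have h3 : S ≤ S * R / ‖x‖ := by
    rw [le_div_iff₀ hx0]
    gcongr
  calc |LstarMu N μ ξ x| ≤ |-lap ξ x| + |2 * tauPlus N μ / ‖x‖ ^ 2 * fderiv ℝ ξ x x| :=
        abs_sub _ _
    _ ≤ S * R / ‖x‖ + |2 * tauPlus N μ| * D / ‖x‖ := by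
        rw [abs_neg]
        exact add_le_add ((hlap x).trans h3) h2
    _ = _ := by ring

theorem LstarMu_sub_const_mul (h : IsC11c ξ) (h' : IsC11c η) (μ c : ℝ) :
    ∀ᵐ x, LstarMu N μ (fun x => ξ x - c * η x) x = LstarMu N μ ξ x - c * LstarMu N μ η x := by
  filter_upwards [h.ae_differentiableAt_fderiv, h'.ae_differentiableAt_fderiv] with x hx hx'
  have e : ∀ y, fderiv ℝ (fun x => ξ x - c * η x) y = fderiv ℝ ξ y - c • fderiv ℝ η y :=
    fun y => by
      rw [fderiv_fun_sub (h.2.1 y) ((h'.2.1 y).const_mul c), fderiv_const_mul (h'.2.1 y)]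
  have e2 : ∀ v, fderiv ℝ (fun y => fderiv ℝ ξ y v - c * fderiv ℝ η y v) x =
      fderiv ℝ (fun y => fderiv ℝ ξ y v) x - c • fderiv ℝ (fun y => fderiv ℝ η y v) x :=
    fun v => by
      have d1 : DifferentiableAt ℝ (fun y => fderiv ℝ ξ y v) x :=
        hx.clm_apply (differentiableAt_const v)
      have d2 : DifferentiableAt ℝ (fun y => fderiv ℝ η y v) x :=
        hx'.clm_apply (differentiableAt_const v)
      rw [fderiv_fun_sub d1 (d2.const_mul c), fderiv_const_mul d2]
  simp only [LstarMu, lap, e, sub_apply, smul_apply,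
    smul_eq_mul, e2, Finset.sum_sub_distrib, ← Finset.mul_sum]
  ring

theorem integrable_mul_LstarMu_sub (hN : 3 ≤ N) {μ : ℝ} {w W : Euc N → ℝ} (h : IsC11c ξ)
    (hw : ContinuousOn w {x | x ≠ 0})
    (hi : ∀ R, IntegrableOn (fun x => w x / ‖x‖) (closedBall 0 R))
    (hiW : ∀ R, IntegrableOn (fun x => w x * W x) (closedBall 0 R)) :
    Integrable (fun x => w x * (LstarMu N μ ξ x - μ * W x * ξ x)) := by
  obtain ⟨C, R, hC0, hC, hR⟩ := h.exists_abs_LstarMu_le μ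
  obtain ⟨B, hB⟩ := h.1.exists_bound_of_continuous h.contDiff.continuous
  have h1 : IntegrableOn (fun x => w x * LstarMu N μ ξ x) (closedBall 0 R) := by
    refine ((hi R).norm.const_mul C).mono' ((aestronglyMeasurable_of_continuousOn_ne_zero hN
      hw).mul (h.measurable_LstarMu μ).aestronglyMeasurable).restrict ?_
    filter_upwards [ae_restrict_of_ae (ae_ne_zero hN)] with x hx
    rw [norm_mul, norm_div, norm_norm]
    calc ‖w x‖ * ‖LstarMu N μ ξ x‖ ≤ ‖w x‖ * (C / ‖x‖) := by
          gcongr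
          exact hC x hx
      _ = _ := by ring
  have h2 : IntegrableOn (fun x => w x * W x * ξ x) (closedBall 0 R) :=
    Integrable.mul_bdd (hiW R) h.contDiff.continuous.aestronglyMeasurable (ae_of_all _ hB)
  have h3 : IntegrableOn (fun x => w x * (LstarMu N μ ξ x - μ * W x * ξ x)) (closedBall 0 R) :=
    (h1.sub (h2.const_mul μ)).congr (ae_of_all _ fun x => by
      simp only [Pi.sub_apply]
      ring)
  refine h3.integrable_of_forall_notMem_eq_zero fun x hx => ?_
  obtain ⟨e1, e2⟩ := hR x hx
  simp [e1, e2]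

end IsC11c

theorem exists_bound_deriv_smoothTransition :
    ∃ M, 0 ≤ M ∧ ∀ t : ℝ, |t * deriv Real.smoothTransition (t + -1)| ≤ M ∧
      |t ^ 2 * deriv (deriv Real.smoothTransition) (t + -1)| ≤ M := by
  have hout : ∀ t : ℝ, t ∉ Set.Icc (1 : ℝ) 2 → deriv Real.smoothTransition (t + -1) = 0 ∧
      deriv (deriv Real.smoothTransition) (t + -1) = 0 := fun t ht => by
    rcases lt_or_ge t 1 with h | h
    · exact deriv_smoothTransition_of_neg (by linarith)
    · refine deriv_smoothTransition_of_one_lt ?_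
      by_contra h'
      exact ht ⟨h, by linarith⟩
  obtain ⟨M, hM⟩ := (HasCompactSupport.intro (f := fun t : ℝ =>
      t * deriv Real.smoothTransition (t + -1)) isCompact_Icc fun t ht => by
        rw [(hout t ht).1, mul_zero]).exists_bound_of_continuous
    (continuous_id.mul (continuous_deriv_smoothTransition.comp (by fun_prop)))
  obtain ⟨M', hM'⟩ := (HasCompactSupport.intro (f := fun t : ℝ =>
      t ^ 2 * deriv (deriv Real.smoothTransition) (t + -1)) isCompact_Icc fun t ht => by
        rw [(hout t ht).2, mul_zero]).exists_bound_of_continuous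
    ((continuous_pow 2).mul (continuous_deriv_deriv_smoothTransition.comp (by fun_prop)))
  exact ⟨max M M', ((norm_nonneg _).trans (hM 0)).trans (le_max_left _ _),
    fun t => ⟨(hM t).trans (le_max_left _ _), (hM' t).trans (le_max_right _ _)⟩⟩

/-- Removing the origin does not matter for test functions that vanish there. -/
theorem integral_eq_zero_of_apply_zero {N : ℕ} (hN : 3 ≤ N) {μ : ℝ} {w W ζ : Euc N → ℝ}
    (hid : ∀ ξ : Euc N → ℝ, IsC11c ξ → ξ =ᶠ[𝓝 0] 0 →
      ∫ x, w x * (LstarMu N μ ξ x - μ * W x * ξ x) = 0)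
    (hw : ContinuousOn w {x | x ≠ 0})
    (hi : ∀ R, IntegrableOn (fun x => w x / ‖x‖) (closedBall 0 R))
    (hiW : ∀ R, IntegrableOn (fun x => w x * W x) (closedBall 0 R))
    (hζ : IsC11c ζ) (hζ0 : ζ 0 = 0) :
    ∫ x, w x * (LstarMu N μ ζ x - μ * W x * ζ x) = 0 := by
  obtain ⟨C, hC⟩ := hζ.exists_lipschitzWith
  obtain ⟨M, hM0, hM⟩ := exists_bound_deriv_smoothTransition
  have hζC : ∀ x, |ζ x| ≤ C * ‖x‖ := fun x => by
    simpa [hζ0] using hC.dist_le_mul x 0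
  have hDC : ∀ x, |fderiv ℝ ζ x x| ≤ C * ‖x‖ := fun x =>
    (ContinuousLinearMap.le_opNorm _ _).trans
      (mul_le_mul_of_nonneg_right (norm_fderiv_le_of_lipschitz ℝ hC) (norm_nonneg x))
  set K := 1 + 2 * Real.sqrt (mu0 N - μ)
  have hK : 0 ≤ K := by positivity
  set ν : ℕ → ℝ := fun n => n + 1
  have hν1 : ∀ n, 1 ≤ ν n := fun n => by simp [ν]
  have hν0 : ∀ n, 0 < ν n := fun n => by linarith [hν1 n]
  have hνt : Tendsto ν atTop atTop :=
    tendsto_atTop_add_const_right _ _ tendsto_natCast_atTop_atTop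
  set κ : ℕ → ℝ → ℝ := fun n r => Real.smoothTransition (ν n * r + -1)
  set κ' : ℕ → ℝ → ℝ := fun n r => ν n * deriv Real.smoothTransition (ν n * r + -1)
  set κ'' : ℕ → ℝ → ℝ := fun n r =>
    ν n ^ 2 * deriv (deriv Real.smoothTransition) (ν n * r + -1)
  have hκ : ∀ n, HasTwoDerivs (κ n) (κ' n) (κ'' n) := fun n =>
    hasTwoDerivs_smoothTransition_affine (ν n) (-1)
  have hκ0 : ∀ n r, r < (ν n)⁻¹ → κ n r = 0 := fun n r hr => by
    refine Real.smoothTransition.zero_of_nonpos ?_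
    have := (mul_lt_mul_of_pos_left hr (hν0 n)).le
    rw [mul_inv_cancel₀ (hν0 n).ne'] at this
    linarith
  have hκ1 : ∀ n r, 2 < ν n * r → κ n r = 1 ∧ κ' n r = 0 ∧ κ'' n r = 0 := fun n r hr => by
    have h : 1 < ν n * r + -1 := by linarith
    obtain ⟨h1, h2⟩ := deriv_smoothTransition_of_one_lt h
    simp only [κ, κ', κ'']
    rw [h1, h2, mul_zero, mul_zero]
    exact ⟨Real.smoothTransition.one_of_one_le h.le, rfl, rfl⟩
  have hκ2 : ∀ n r, 2 < r → κ n r = 1 ∧ κ' n r = 0 ∧ κ'' n r = 0 := fun n r hr =>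
    hκ1 n r (by nlinarith [hν1 n])
  have hcd : ∀ n, ContDiff ℝ 2 (fun x : Euc N => κ n ‖x‖) := fun n =>
    (hκ n).contDiff_comp_norm (inv_pos.2 (hν0 n)) (hκ0 n)
  have htest : ∀ n, IsC11c (fun x => ζ x * κ n ‖x‖) := fun n => by
    have h1 : IsC11c (fun x : Euc N => 1 - κ n ‖x‖) :=
      IsC11c.of_contDiff (contDiff_const.sub (hcd n))
        (hasCompactSupport_comp_norm (φ := fun r => 1 - κ n r) (R := 2) fun r hr => by
          simp only [(hκ2 n r hr).1, sub_self])
    convert hζ.sub (hζ.mul h1) using 2 with x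
    ring
  set G : ℕ → Euc N → ℝ := fun n x =>
    κ n ‖x‖ * (w x * (LstarMu N μ ζ x - μ * W x * ζ x)) +
      w x * (ζ x * radialOp N μ (κ' n ‖x‖) (κ'' n ‖x‖) ‖x‖ -
        2 * κ' n ‖x‖ / ‖x‖ * fderiv ℝ ζ x x)
  have hG : ∀ n, (fun x => w x * (LstarMu N μ (fun x => ζ x * κ n ‖x‖) x -
      μ * W x * (ζ x * κ n ‖x‖))) =ᵐ[volume] G n := fun n => by
    filter_upwards [ae_ne_zero hN, hζ.ae_differentiableAt_fderiv] with x hx hx'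
    rw [LstarMu_mul_comp_norm (hκ n).hasDerivAt (hκ n).hasDerivAt' hx hζ.2.1 hx']
    simp only [G]
    ring
  have hFi := hζ.integrable_mul_LstarMu_sub hN (μ := μ) hw hi hiW
  have hi2 : IntegrableOn (fun x => C * M * (3 + K) * ‖w x / ‖x‖‖) (closedBall 0 2) :=
    (hi 2).norm.const_mul _
  have hbi : Integrable (fun x => |w x * (LstarMu N μ ζ x - μ * W x * ζ x)| +
      (closedBall (0 : Euc N) 2).indicator (fun x => C * M * (3 + K) * ‖w x / ‖x‖‖) x) :=
    hFi.abs.add (hi2.integrable_indicator measurableSet_closedBall)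
  have hlim : Tendsto (fun n => ∫ x, G n x) atTop
      (𝓝 (∫ x, w x * (LstarMu N μ ζ x - μ * W x * ζ x))) := by
    refine tendsto_integral_of_dominated_convergence _ (fun n => ?_) hbi (fun n => ?_) ?_
    · exact (((htest n).integrable_mul_LstarMu_sub hN hw hi hiW).congr
        (hG n)).aestronglyMeasurable
    · filter_upwards [ae_ne_zero hN] with x hx
      have hx0 : 0 < ‖x‖ := norm_pos_iff.2 hx
      refine (norm_add_le _ _).trans (add_le_add ?_ ?_)
      · rw [norm_mul]
        refine mul_le_of_le_one_left (norm_nonneg _) ?_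
        rw [Real.norm_of_nonneg (Real.smoothTransition.nonneg _)]
        exact Real.smoothTransition.le_one _
      · by_cases hx2 : x ∈ closedBall (0 : Euc N) 2
        · rw [Set.indicator_of_mem hx2]
          have b1 : |κ' n ‖x‖| ≤ M / ‖x‖ := by
            rw [le_div_iff₀ hx0, ← abs_of_pos hx0, ← abs_mul, abs_of_pos hx0]
            refine le_of_eq_of_le ?_ (hM (ν n * ‖x‖)).1
            simp only [κ']
            ring_nf
          have b2 : |κ'' n ‖x‖| ≤ M / ‖x‖ ^ 2 := by
            rw [le_div_iff₀ (pow_pos hx0 2), ← sq_abs ‖x‖, ← abs_pow, ← abs_mul]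
            refine le_of_eq_of_le ?_ (hM (ν n * ‖x‖)).2
            simp only [κ'']
            ring_nf
          have b3 : |radialOp N μ (κ' n ‖x‖) (κ'' n ‖x‖) ‖x‖| ≤ M * (1 + K) / ‖x‖ ^ 2 := by
            rw [radialOp, abs_neg]
            calc _ ≤ |κ'' n ‖x‖| + |K / ‖x‖ * κ' n ‖x‖| := abs_add_le _ _
              _ ≤ M / ‖x‖ ^ 2 + K / ‖x‖ * (M / ‖x‖) := by
                rw [abs_mul (K / ‖x‖), abs_of_nonneg (by positivity : 0 ≤ K / ‖x‖)]
                gcongr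
              _ = _ := by
                field_simp
          have b4 : |ζ x * radialOp N μ (κ' n ‖x‖) (κ'' n ‖x‖) ‖x‖ -
              2 * κ' n ‖x‖ / ‖x‖ * fderiv ℝ ζ x x| ≤ C * M * (3 + K) / ‖x‖ := by
            calc _ ≤ |ζ x * radialOp N μ (κ' n ‖x‖) (κ'' n ‖x‖) ‖x‖| +
                  |2 * κ' n ‖x‖ / ‖x‖ * fderiv ℝ ζ x x| := abs_sub _ _
              _ = |ζ x| * |radialOp N μ (κ' n ‖x‖) (κ'' n ‖x‖) ‖x‖| +
                  2 * |κ' n ‖x‖| / ‖x‖ * |fderiv ℝ ζ x x| := by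
                rw [abs_mul, abs_mul, abs_div, abs_mul, abs_of_pos hx0, abs_two]
              _ ≤ C * ‖x‖ * (M * (1 + K) / ‖x‖ ^ 2) + 2 * (M / ‖x‖) / ‖x‖ * (C * ‖x‖) := by
                gcongr
                exacts [hζC x, hDC x]
              _ = _ := by
                field_simp
                ring
          rw [norm_mul, norm_div, norm_norm]
          calc _ ≤ ‖w x‖ * (C * M * (3 + K) / ‖x‖) := by
                gcongr
                exact b4
            _ = _ := by ring
        · obtain ⟨-, h2, h3⟩ := hκ2 n ‖x‖ (by simpa using hx2)
          simp [h2, h3, radialOp, Set.indicator_of_notMem hx2]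
    · filter_upwards [ae_ne_zero hN] with x hx
      have hx0 : 0 < ‖x‖ := norm_pos_iff.2 hx
      refine tendsto_const_nhds.congr' ?_
      filter_upwards [hνt.eventually_gt_atTop (2 / ‖x‖)] with n hn
      obtain ⟨h1, h2, h3⟩ := hκ1 n ‖x‖ (by rwa [div_lt_iff₀ hx0] at hn)
      simp [G, h1, h2, h3, radialOp]
  refine tendsto_nhds_unique hlim (tendsto_const_nhds.congr fun n => ?_)
  rw [← integral_congr_ae (hG n), hid _ (htest n)]
  filter_upwards [ball_mem_nhds (0 : Euc N) (inv_pos.2 (hν0 n))] with y hy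
  rw [hκ0 n _ (by simpa using hy), mul_zero, Pi.zero_apply]

theorem cMu_pos {N : ℕ} (hN : 3 ≤ N) (μ : ℝ) : 0 < cMu N μ := by
  have hs : 0 < sphereArea N := by
    have : 0 < (volume (ball (0 : Euc N) 1)).toReal :=
      ENNReal.toReal_pos (measure_ball_pos volume _ one_pos).ne' measure_ball_lt_top.ne
    have : (0 : ℝ) < N := by exact_mod_cast (by omega : 0 < N)
    unfold sphereArea
    positivity
  unfold cMu
  split_ifs with h
  · have := Real.sqrt_pos.2 (sub_pos.2 h)
    positivity
  · exact hs

theorem LocHolderOn.continuousOn {N : ℕ} {γ : ℝ} (hγ : 0 < γ) {s : Set (Euc N)} {f : Euc N → ℝ}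
    (h : LocHolderOn γ s f) : ContinuousOn f s := by
  intro x hx
  obtain ⟨ε, hε, C, -, hC⟩ := h x hx
  rw [ContinuousWithinAt, tendsto_iff_dist_tendsto_zero]
  have h1 : Tendsto (fun y => C * dist y x ^ γ) (𝓝[s] x) (𝓝 0) := by
    have : Continuous fun y => C * dist y x ^ γ :=
      continuous_const.mul ((continuous_id.dist continuous_const).rpow_const
        fun _ => Or.inr hγ.le)
    simpa [Real.zero_rpow hγ.ne'] using (this.tendsto x).mono_left nhdsWithin_le_nhds
  refine squeeze_zero' (Eventually.of_forall fun _ => dist_nonneg) ?_ h1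
  filter_upwards [self_mem_nhdsWithin, mem_nhdsWithin_of_mem_nhds (ball_mem_nhds x hε)]
    with y hy hy'
  exact hC y ⟨hy', hy⟩ x ⟨mem_ball_self hε, hx⟩

/-- Proposition 1.1, second part: every positive singular solution satisfies the
dμ-distributional identity for some k ≥ 0. -/
theorem solution_satisfies_distributional_identity
    (N : ℕ) (hN : 3 ≤ N) (μ : ℝ) (hμ : 0 < μ) (hμ0 : μ ≤ mu0 N)
    (γ : ℝ) (hγ : 0 < γ ∧ γ < 1) (V : Euc N → ℝ)
    (hVreg : LocHolderOn γ {x : Euc N | x ≠ 0} V)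
    (hVpos : ∀ x : Euc N, x ≠ 0 → 0 < V x)
    (hVlower : ∀ x : Euc N, x ≠ 0 → ‖x‖ ^ (-2 : ℝ) ≤ V x)
    (hVlim : Tendsto (fun x : Euc N => V x * ‖x‖ ^ 2)
      (nhdsWithin (0 : Euc N) {x : Euc N | x ≠ 0}) (nhds 1))
    (u : Euc N → ℝ) (hu : IsSolution N μ V u)
    (hne : ∃ x : Euc N, x ≠ 0 ∧ u x ≠ 0)
    (r : ℝ) (hr : 0 < r) (hupos : ∀ x : Euc N, x ≠ 0 → ‖x‖ < r → 0 ≤ u x) :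
    ∃ k : ℝ, 0 ≤ k ∧ DistribIdentity N μ V u k := by
  have hwc : ContinuousOn (fun x => u x * ‖x‖ ^ tauPlus N μ) {x | x ≠ 0} :=
    hu.1.continuousOn.mul (continuous_norm.continuousOn.rpow_const
      fun x hx => Or.inl (norm_ne_zero_iff.2 hx))
  have hWc : ContinuousOn (fun x => V x - ‖x‖ ^ (-2 : ℝ)) {x | x ≠ 0} :=
    (hVreg.continuousOn hγ.1).sub (continuous_norm.continuousOn.rpow_const
      fun x hx => Or.inl (norm_ne_zero_iff.2 hx))
  have hrad := radialTestIdentity hN hμ0 hu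
  have e : ∀ ξ : Euc N → ℝ, (fun x => u x * LstarMuV N μ V ξ x * ‖x‖ ^ tauPlus N μ) = fun x =>
      u x * ‖x‖ ^ tauPlus N μ * (LstarMu N μ ξ x - μ * (V x - ‖x‖ ^ (-2 : ℝ)) * ξ x) :=
    fun ξ => funext fun x => by
      rw [LstarMuV]
      ring
  have hid : ∀ ξ : Euc N → ℝ, IsC11c ξ → ξ =ᶠ[𝓝 0] 0 → ∫ x, u x * ‖x‖ ^ tauPlus N μ *
      (LstarMu N μ ξ x - μ * (V x - ‖x‖ ^ (-2 : ℝ)) * ξ x) = 0 := fun ξ hξ h0 => by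
    rw [← e]
    exact (integral_mul_LstarMuV_of_vanish_near_zero hN hμ0 hu hξ h0).2
  have hw0 : ∀ x : Euc N, x ≠ 0 → ‖x‖ ≤ 2 * (r / 4) → 0 ≤ u x * ‖x‖ ^ tauPlus N μ :=
    fun x hx hxr => mul_nonneg (hupos x hx (by linarith)) (Real.rpow_nonneg (norm_nonneg x) _)
  have hW0 : ∀ x : Euc N, x ≠ 0 → 0 ≤ V x - ‖x‖ ^ (-2 : ℝ) := fun x hx =>
    sub_nonneg.2 (hVlower x hx)
  set w : Euc N → ℝ := fun x => u x * ‖x‖ ^ tauPlus N μ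
  set W : Euc N → ℝ := fun x => V x - ‖x‖ ^ (-2 : ℝ)
  have hδ : 0 < r / 4 := by positivity
  set δ := r / 4
  obtain ⟨χ, χ', χ'', hχ⟩ := exists_isRadialCutoff hδ
  obtain ⟨hWχ, hWχle⟩ := hrad.integrable_mul_cutoff hN hμ hwc hWc hδ hw0 hW0 hχ
  have hi : ∀ R, IntegrableOn (fun x => w x / ‖x‖) (closedBall 0 R) :=
    integrableOn_closedBall_of_ball (hwc.div continuous_norm.continuousOn
      fun x hx => norm_ne_zero_iff.2 hx) hδ
      (hrad.integrableOn_div_norm hN hμ.le hwc hWc hδ hw0 hW0 hχ)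
  have hiW : ∀ R, IntegrableOn (fun x => w x * W x) (closedBall 0 R) :=
    integrableOn_closedBall_of_ball (hwc.mul hWc) hδ (hWχ.integrableOn.congr_fun
      (fun x hx => by
        simp only [(hχ.eq_one ‖x‖ (by simpa using hx)).1, mul_one]) measurableSet_ball)
  have hη : IsC11c (fun x : Euc N => χ ‖x‖) :=
    IsC11c.of_contDiff (hχ.hasTwoDerivs.contDiff_comp_norm hδ fun r hr => (hχ.eq_one r hr).1)
      (hasCompactSupport_comp_norm fun r hr => (hχ.eq_zero r hr).1)
  have hη0 : χ ‖(0 : Euc N)‖ = 1 := (hχ.eq_one _ (by simpa using hδ)).1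
  set T : (Euc N → ℝ) → ℝ := fun ξ => ∫ x, w x * (LstarMu N μ ξ x - μ * W x * ξ x)
  have hint := fun ξ (hξ : IsC11c ξ) => hξ.integrable_mul_LstarMu_sub hN (μ := μ) hwc hi hiW
  have hT0 : 0 ≤ T (fun x => χ ‖x‖) := by
    have hz : ∀ x : Euc N, x ∉ (ball (0 : Euc N) δ)ᶜ →
        w x * radialOp N μ (χ' ‖x‖) (χ'' ‖x‖) ‖x‖ = 0 := fun x hx => by
      obtain ⟨-, h2, h3⟩ := hχ.eq_one ‖x‖ (by simpa using hx)
      simp [h2, h3, radialOp]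
    have hA := setIntegral_eq_integral_of_forall_compl_eq_zero (μ := volume) hz
    have hAi := hχ.integrableOn_outer (μ := μ) hδ hwc
      (k := fun _ => 1) (k' := fun _ => 0) (k'' := fun _ => 0) ⟨fun r _ => hasDerivAt_const r 1,
        fun r _ => hasDerivAt_const r 0, continuousOn_const⟩
    simp only [outerFlux, mul_one, mul_zero, add_zero] at hWχle hAi
    rw [hA] at hWχle
    have hAi' := hAi.integrable_of_forall_notMem_eq_zero hz
    have : T (fun x => χ ‖x‖) = (∫ x, w x * radialOp N μ (χ' ‖x‖) (χ'' ‖x‖) ‖x‖) -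
        μ * ∫ x, w x * W x * χ ‖x‖ := by
      rw [← integral_const_mul, ← integral_sub hAi' (hWχ.const_mul μ)]
      refine integral_congr_ae ?_
      filter_upwards [ae_ne_zero hN] with x hx
      rw [LstarMu_comp_norm hχ.hasTwoDerivs.hasDerivAt hχ.hasTwoDerivs.hasDerivAt' hx]
      ring
    linarith
  refine ⟨T (fun x => χ ‖x‖) / cMu N μ, div_nonneg hT0 (cMu_pos hN μ).le, fun ξ hξ => ?_⟩
  rw [mul_div_cancel₀ _ (cMu_pos hN μ).ne', e]
  have hζ := integral_eq_zero_of_apply_zero hN hid hwc hi hiW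
    (hξ.sub (hη.const_mul (ξ 0))) (by rw [hη0, mul_one, sub_self])
  have hsub : T (fun x => ξ x - ξ 0 * χ ‖x‖) = T ξ - ξ 0 * T (fun x => χ ‖x‖) := by
    simp only [T]
    rw [← integral_const_mul, ← integral_sub (hint _ hξ) ((hint _ hη).const_mul _)]
    refine integral_congr_ae ?_
    filter_upwards [hξ.LstarMu_sub_const_mul hη μ (ξ 0)] with x hx
    rw [hx]
    ring
  change T ξ = _
  change T _ = 0 at hζ
  linarith
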